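/- Let d ≥ 1, t ∈ (0, 1/2], and let A, B ⊆ ℝ^d be measurable sets of equal positive finite volume with |tA + (1−t)B| < (1 + t^d)·|A|. Then there is a translation vector v ∈ ℝ^d such that |co(A ∪ (B + v))| ≤ (2/(t(1−t)))^{4d²}·|A|. -/

import Mathlib

open MeasureTheory Pointwise

open scoped ENNReal

theorem Real.volume_add_volume_le_volume_add_of_isCompact {X Y : Set ℝ} (hX : IsCompact X)
    (hY : IsCompact Y) (hX0 : X.Nonempty) (hY0 : Y.Nonempty) :
    volume X + volume Y ≤ volume (X + Y) := by
  obtain ⟨a, haX, ha⟩ := hX.exists_isGreatest hX0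
  obtain ⟨b, hbY, hb⟩ := hY.exists_isLeast hY0
  have hd : AEDisjoint volume (b +ᵥ X) (a +ᵥ Y) := by
    refine measure_mono_null (t := {a + b}) ?_ (by simp)
    rintro _ ⟨⟨x, hx, rfl⟩, ⟨y, hy, hxy⟩⟩
    have h1 := ha hx
    have h2 := hb hy
    simp only [vadd_eq_add, Set.mem_singleton_iff] at hxy ⊢
    linarith
  have hm : NullMeasurableSet (a +ᵥ Y) := (hY.vadd a).measurableSet.nullMeasurableSet
  calc volume X + volume Y = volume (b +ᵥ X) + volume (a +ᵥ Y) := by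
        simp only [measure_vadd]
    _ = volume ((b +ᵥ X) ∪ (a +ᵥ Y)) := (measure_union₀ hm hd).symm
    _ ≤ volume (X + Y) := by
        apply measure_mono
        rintro _ (⟨x, hx, rfl⟩ | ⟨y, hy, rfl⟩)
        · exact ⟨x, hx, b, hbY, add_comm _ _⟩
        · exact ⟨a, haX, y, hy, rfl⟩

theorem Real.volume_add_volume_le_volume_add {X Y : Set ℝ} (hX : MeasurableSet X)
    (hY : MeasurableSet Y) (hX0 : X.Nonempty) (hY0 : Y.Nonempty) :
    volume X + volume Y ≤ volume (X + Y) := by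
  obtain ⟨x₀, hx₀⟩ := hX0
  obtain ⟨y₀, hy₀⟩ := hY0
  rw [hX.measure_eq_iSup_isCompact, hY.measure_eq_iSup_isCompact]
  simp only [iSup_and']
  refine ENNReal.biSup_add_biSup_le' ⟨∅, by simp⟩ ⟨∅, by simp⟩ ?_
  rintro C ⟨hCX, hC⟩ D ⟨hDY, hD⟩
  calc volume C + volume D ≤ volume (insert x₀ C) + volume (insert y₀ D) := by
        gcongr <;> exact Set.subset_insert _ _
    _ ≤ volume (insert x₀ C + insert y₀ D) :=
        Real.volume_add_volume_le_volume_add_of_isCompact (hC.insert _) (hD.insert _)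
          (Set.insert_nonempty _ _) (Set.insert_nonempty _ _)
    _ ≤ volume (X + Y) :=
        measure_mono (Set.add_subset_add (Set.insert_subset hx₀ hCX) (Set.insert_subset hy₀ hDY))

theorem lintegral_eq_lintegral_Ioo_meas_lt {f : ℝ → ℝ≥0∞} (hf : Measurable f)
    (hf1 : ∀ x, f x ≤ 1) :
    ∫⁻ x, f x = ∫⁻ s in Set.Ioo (0 : ℝ) 1, volume {x | ENNReal.ofReal s < f x} := by
  have hfin : ∀ x, f x ≠ ∞ := fun x => ne_top_of_le_ne_top ENNReal.one_ne_top (hf1 x)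
  have h1 : ∫⁻ x, f x = ∫⁻ x, ENNReal.ofReal (f x).toReal := by
    simp only [ENNReal.ofReal_toReal (hfin _)]
  rw [h1, lintegral_eq_lintegral_meas_lt volume (Filter.Eventually.of_forall fun x => by simp)
    hf.ennreal_toReal.aemeasurable]
  rw [← lintegral_indicator measurableSet_Ioi, ← lintegral_indicator measurableSet_Ioo]
  refine lintegral_congr fun s => ?_
  by_cases hs : s ∈ Set.Ioo (0 : ℝ) 1
  · rw [Set.indicator_of_mem hs, Set.indicator_of_mem (show s ∈ Set.Ioi (0 : ℝ) from hs.1)]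
    congr 1
    ext x
    exact (ENNReal.ofReal_lt_iff_lt_toReal hs.1.le (hfin x)).symm
  · rw [Set.indicator_of_notMem hs]
    by_cases hs0 : s ∈ Set.Ioi (0 : ℝ)
    · rw [Set.indicator_of_mem hs0]
      have : 1 ≤ s := by
        by_contra h
        exact hs ⟨hs0, not_le.1 h⟩
      convert measure_empty (μ := (volume : Measure ℝ))
      ext x
      simp only [Set.mem_ofPred_eq, Set.mem_empty_iff_false, iff_false, not_lt]
      exact (ENNReal.toReal_mono ENNReal.one_ne_top (hf1 x)).trans (by simpa using this)
    · rw [Set.indicator_of_notMem hs0]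

theorem ENNReal.geom_mean_le_arith_mean2 {p q : ℝ} (hp : 0 < p) (hq : 0 < q) (hpq : p + q = 1)
    (a b : ℝ≥0∞) : a ^ p * b ^ q ≤ ENNReal.ofReal p * a + ENNReal.ofReal q * b := by
  by_cases ha : a = ∞
  · simp [ha, ENNReal.mul_top, hp]
  by_cases hb : b = ∞
  · simp [hb, ENNReal.mul_top, hq]
  lift a to NNReal using ha
  lift b to NNReal using hb
  rw [← ENNReal.coe_rpow_of_nonneg _ hp.le, ← ENNReal.coe_rpow_of_nonneg _ hq.le,
    ENNReal.ofReal, ENNReal.ofReal]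
  norm_cast
  have := NNReal.geom_mean_le_arith_mean2_weighted p.toNNReal q.toNNReal a b (by
    rw [← Real.toNNReal_add hp.le hq.le, hpq, Real.toNNReal_one])
  simpa [hp.le, hq.le] using this

section PrekopaLeindler

variable {p q : ℝ}

theorem prekopaLeindler_real_of_normalized (hp : 0 < p) (hq : 0 < q) (hpq : p + q = 1)
    {f g h : ℝ → ℝ≥0∞} (hf : Measurable f) (hg : Measurable g) (hh : Measurable h)
    (hf1 : ∀ x, f x ≤ 1) (hg1 : ∀ x, g x ≤ 1)
    (hfs : ∀ s < 1, ∃ x, s < f x) (hgs : ∀ s < 1, ∃ x, s < g x)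
    (H : ∀ x y, f x ^ p * g y ^ q ≤ h (p * x + q * y)) :
    ENNReal.ofReal p * (∫⁻ x, f x) + ENNReal.ofReal q * (∫⁻ x, g x) ≤ ∫⁻ x, h x := by
  calc ENNReal.ofReal p * (∫⁻ x, f x) + ENNReal.ofReal q * (∫⁻ x, g x)
      ≤ ∫⁻ x, min (h x) 1 := ?_
    _ ≤ ∫⁻ x, h x := lintegral_mono fun x => min_le_left _ _
  rw [lintegral_eq_lintegral_Ioo_meas_lt hf hf1, lintegral_eq_lintegral_Ioo_meas_lt hg hg1,
    lintegral_eq_lintegral_Ioo_meas_lt (hh.min measurable_const) fun x => min_le_right _ _,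
    ← lintegral_const_mul' _ _ ENNReal.ofReal_ne_top,
    ← lintegral_const_mul' _ _ ENNReal.ofReal_ne_top, ← lintegral_add_left']
  · refine setLIntegral_mono' measurableSet_Ioo fun s hs => ?_
    have hs1 : ENNReal.ofReal s < 1 := by simpa using hs.2
    set X := {x | ENNReal.ofReal s < f x}
    set Y := {x | ENNReal.ofReal s < g x}
    have hX : MeasurableSet X := measurableSet_lt measurable_const hf
    have hY : MeasurableSet Y := measurableSet_lt measurable_const hg
    have e1 : ENNReal.ofReal p * volume X = volume (p • X) := by
      simp [Measure.addHaar_smul, abs_of_pos hp]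
    have e2 : ENNReal.ofReal q * volume Y = volume (q • Y) := by
      simp [Measure.addHaar_smul, abs_of_pos hq]
    rw [e1, e2]
    refine (Real.volume_add_volume_le_volume_add (hX.const_smul₀ p) (hY.const_smul₀ q)
      (Set.Nonempty.smul_set (hfs _ hs1)) (Set.Nonempty.smul_set (hgs _ hs1))).trans
      (measure_mono ?_)
    rintro _ ⟨_, ⟨x, hx, rfl⟩, _, ⟨y, hy, rfl⟩, rfl⟩
    refine lt_min (lt_of_lt_of_le ?_ (H x y)) hs1
    calc ENNReal.ofReal s = ENNReal.ofReal s ^ p * ENNReal.ofReal s ^ q := by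
          rw [← ENNReal.rpow_add_of_nonneg _ _ hp.le hq.le, hpq, ENNReal.rpow_one]
      _ < f x ^ p * g y ^ q :=
          ENNReal.mul_lt_mul (ENNReal.rpow_lt_rpow hx hp) (ENNReal.rpow_lt_rpow hy hq)
  · refine AEMeasurable.const_mul ?_ _
    have : Antitone fun s : ℝ => volume {x | ENNReal.ofReal s < f x} := fun s t hst =>
      measure_mono fun x hx => (ENNReal.ofReal_le_ofReal hst).trans_lt hx
    exact this.measurable.aemeasurable

theorem prekopaLeindler_real_of_bounded (hp : 0 < p) (hq : 0 < q) (hpq : p + q = 1)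
    {f g h : ℝ → ℝ≥0∞} (hf : Measurable f) (hg : Measurable g) (hh : Measurable h)
    (hfb : ⨆ x, f x ≠ ∞) (hgb : ⨆ x, g x ≠ ∞)
    (H : ∀ x y, f x ^ p * g y ^ q ≤ h (p * x + q * y)) :
    (∫⁻ x, f x) ^ p * (∫⁻ x, g x) ^ q ≤ ∫⁻ x, h x := by
  set A := ⨆ x, f x with hA
  set B := ⨆ x, g x with hB
  by_cases hA0 : A = 0
  · have : ∀ x, f x = 0 := fun x => le_antisymm (hA0 ▸ le_iSup f x) zero_le
    simp [this, hp]
  by_cases hB0 : B = 0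
  · have : ∀ x, g x = 0 := fun x => le_antisymm (hB0 ▸ le_iSup g x) zero_le
    simp [this, hq]
  set c := A ^ p * B ^ q with hc
  have hc0 : c ≠ 0 := by simp [hc, hA0, hB0, hfb, hgb]
  have hct : c ≠ ∞ := ENNReal.mul_ne_top (ENNReal.rpow_ne_top_of_nonneg hp.le hfb)
    (ENNReal.rpow_ne_top_of_nonneg hq.le hgb)
  have key := prekopaLeindler_real_of_normalized hp hq hpq (f := fun x => f x / A)
    (g := fun x => g x / B) (h := fun x => h x / c) (hf.div_const _) (hg.div_const _)
    (hh.div_const _) (fun x => ENNReal.div_le_of_le_mul (by simpa using le_iSup f x))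
    (fun x => ENNReal.div_le_of_le_mul (by simpa using le_iSup g x))
    (fun s hs => by
      have : s * A < ⨆ x, f x := by
        simpa using (ENNReal.mul_lt_mul_iff_left hA0 hfb).2 hs
      obtain ⟨x, hx⟩ := lt_iSup_iff.1 this
      exact ⟨x, (ENNReal.lt_div_iff_mul_lt (Or.inl hA0) (Or.inl hfb)).2 hx⟩)
    (fun s hs => by
      have : s * B < ⨆ x, g x := by
        simpa using (ENNReal.mul_lt_mul_iff_left hB0 hgb).2 hs
      obtain ⟨x, hx⟩ := lt_iSup_iff.1 this
      exact ⟨x, (ENNReal.lt_div_iff_mul_lt (Or.inl hB0) (Or.inl hgb)).2 hx⟩)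
    (fun x y => by
      rw [ENNReal.div_rpow_of_nonneg _ _ hp.le, ENNReal.div_rpow_of_nonneg _ _ hq.le]
      have : f x ^ p / A ^ p * (g y ^ q / B ^ q) = f x ^ p * g y ^ q / c := by
        rw [hc, div_eq_mul_inv, div_eq_mul_inv, div_eq_mul_inv,
          ENNReal.mul_inv (Or.inl (by simp [hA0, hfb])) (Or.inr (by simp [hB0, hgb]))]
        ring
      rw [this]
      exact ENNReal.div_le_div_right (H x y) c)
  have e : ∀ (u : ℝ → ℝ≥0∞) (a : ℝ≥0∞), a ≠ 0 → ∫⁻ x, u x / a = (∫⁻ x, u x) / a := by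
    intro u a ha
    simp only [div_eq_mul_inv]
    exact lintegral_mul_const' _ _ (ENNReal.inv_ne_top.2 ha)
  rw [e _ _ hA0, e _ _ hB0, e _ _ hc0] at key
  have := (ENNReal.geom_mean_le_arith_mean2 hp hq hpq _ _).trans key
  rw [ENNReal.div_rpow_of_nonneg _ _ hp.le, ENNReal.div_rpow_of_nonneg _ _ hq.le] at this
  have e3 : (∫⁻ x, f x) ^ p / A ^ p * ((∫⁻ x, g x) ^ q / B ^ q)
      = (∫⁻ x, f x) ^ p * (∫⁻ x, g x) ^ q / c := by
    rw [hc, div_eq_mul_inv, div_eq_mul_inv, div_eq_mul_inv,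
      ENNReal.mul_inv (Or.inl (by simp [hA0, hfb])) (Or.inr (by simp [hB0, hgb]))]
    ring
  rw [e3] at this
  have h2 := mul_le_mul_left this c
  rwa [ENNReal.div_mul_cancel hc0 hct, ENNReal.div_mul_cancel hc0 hct] at h2

theorem prekopaLeindler_real (hp : 0 < p) (hq : 0 < q) (hpq : p + q = 1)
    {f g h : ℝ → ℝ≥0∞} (hf : Measurable f) (hg : Measurable g) (hh : Measurable h)
    (H : ∀ x y, f x ^ p * g y ^ q ≤ h (p * x + q * y)) :
    (∫⁻ x, f x) ^ p * (∫⁻ x, g x) ^ q ≤ ∫⁻ x, h x := by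
  by_cases hf0 : ∫⁻ x, f x = 0
  · simp [hf0, hp]
  by_cases hg0 : ∫⁻ x, g x = 0
  · simp [hg0, hq]
  have trunc : ∀ {u : ℝ → ℝ≥0∞}, Measurable u →
      Filter.Tendsto (fun N : ℕ => ∫⁻ x, min (u x) N) Filter.atTop (nhds (∫⁻ x, u x)) := by
    intro u hu
    refine lintegral_tendsto_of_tendsto_of_monotone
      (fun N => (hu.min measurable_const).aemeasurable)
      (Filter.Eventually.of_forall fun x N M hNM => min_le_min le_rfl (by exact_mod_cast hNM))
      (Filter.Eventually.of_forall fun x => ?_)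
    have := (tendsto_const_nhds (x := u x)).min ENNReal.tendsto_nat_nhds_top
    simpa using this
  have bdd : ∀ (u : ℝ → ℝ≥0∞) (N : ℕ), ⨆ x, min (u x) (N : ℝ≥0∞) ≠ ∞ := fun u N =>
    ne_top_of_le_ne_top (ENNReal.natCast_ne_top N) (iSup_le fun x => min_le_right _ _)
  have lim : Filter.Tendsto (fun N : ℕ => (∫⁻ x, min (f x) N) ^ p * (∫⁻ x, min (g x) N) ^ q)
      Filter.atTop (nhds ((∫⁻ x, f x) ^ p * (∫⁻ x, g x) ^ q)) := by
    refine ENNReal.Tendsto.mul ((trunc hf).ennrpow_const p) (Or.inl ?_)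
      ((trunc hg).ennrpow_const q) (Or.inl ?_)
    · simp [ENNReal.rpow_eq_zero_iff, hf0, hp.le]
    · simp [ENNReal.rpow_eq_zero_iff, hg0, hq.le]
  refine le_of_tendsto' lim fun N => ?_
  refine prekopaLeindler_real_of_bounded hp hq hpq (hf.min measurable_const)
    (hg.min measurable_const) hh (bdd f N) (bdd g N) fun x y => le_trans ?_ (H x y)
  gcongr <;> exact min_le_left _ _

/-- The **Prékopa–Leindler inequality** on `Fin n → ℝ`. -/
theorem prekopaLeindler (hp : 0 < p) (hq : 0 < q) (hpq : p + q = 1) {n : ℕ}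
    {f g h : (Fin n → ℝ) → ℝ≥0∞} (hf : Measurable f) (hg : Measurable g) (hh : Measurable h)
    (H : ∀ x y, f x ^ p * g y ^ q ≤ h (p • x + q • y)) :
    (∫⁻ x, f x) ^ p * (∫⁻ x, g x) ^ q ≤ ∫⁻ x, h x := by
  induction n with
  | zero =>
    have e : ∀ u : (Fin 0 → ℝ) → ℝ≥0∞, ∫⁻ x, u x = u 0 := fun u => by
      rw [lintegral_unique]
      simp only [volume_pi, Measure.pi_univ, Finset.univ_eq_empty, Finset.prod_empty, mul_one]
      congr 1
      exact Subsingleton.elim _ _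
    rw [e, e, e]
    simpa using H 0 0
  | succ n ih =>
    have mp := (volume_preserving_piFinSuccAbove (fun _ : Fin (n + 1) => ℝ) 0).symm
    set E := (MeasurableEquiv.piFinSuccAbove (fun _ : Fin (n + 1) => ℝ) 0).symm with hE
    have hm : ∀ {u : (Fin (n + 1) → ℝ) → ℝ≥0∞}, Measurable u → Measurable fun z => u (E z) :=
      fun hu => hu.comp E.measurable
    have e : ∀ {u : (Fin (n + 1) → ℝ) → ℝ≥0∞}, Measurable u →
        ∫⁻ x, u x = ∫⁻ a, ∫⁻ b, u (E (a, b)) := fun {u} hu => by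
      rw [← mp.lintegral_comp hu]
      exact lintegral_prod _ (hm hu).aemeasurable
    rw [e hf, e hg, e hh]
    refine prekopaLeindler_real hp hq hpq (hm hf).lintegral_prod_right'
      (hm hg).lintegral_prod_right' (hm hh).lintegral_prod_right' fun a a' => ?_
    refine ih ((hm hf).comp measurable_prodMk_left) ((hm hg).comp measurable_prodMk_left)
      ((hm hh).comp measurable_prodMk_left) fun b b' => ?_
    refine (H _ _).trans (le_of_eq ?_)
    congr 1
    ext i
    refine Fin.cases ?_ (fun j => ?_) i <;> simp [hE, MeasurableEquiv.piFinSuccAbove]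

end PrekopaLeindler

theorem ZMod.inv_le_dist_toAddCircle {N : ℕ} [NeZero N] {i j : ZMod N} (hij : i ≠ j) :
    (N : ℝ)⁻¹ ≤ dist (ZMod.toAddCircle i) (ZMod.toAddCircle j) := by
  have hN : (0 : ℝ) < N := by exact_mod_cast NeZero.pos N
  rw [dist_eq_norm, ← map_sub]
  obtain ⟨k, hk⟩ := ZMod.intCast_surjective (i - j)
  rw [← hk, ZMod.toAddCircle_intCast, UnitAddCircle.norm_eq]
  set r := round ((k : ℝ) / N)
  have h0 : k - N * r ≠ 0 := by
    intro h
    apply sub_ne_zero.2 hij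
    rw [← hk, sub_eq_zero.1 h]
    simp
  have h1 : (1 : ℝ) ≤ |((k - N * r : ℤ) : ℝ)| := by
    rw [← Int.cast_abs]
    exact_mod_cast Int.one_le_abs h0
  have h2 : (k : ℝ) / N - r = ((k - N * r : ℤ) : ℝ) / N := by
    push_cast
    field_simp
  rw [h2, abs_div, abs_of_pos hN, inv_eq_one_div]
  gcongr

theorem ZMod.card_mul_inv_le_volume {N : ℕ} [NeZero N] (F : Finset (ZMod N))
    {U : Set UnitAddCircle}
    (hU : ∀ j ∈ F, Metric.ball (ZMod.toAddCircle j) ((N : ℝ)⁻¹ / 2) ⊆ U) :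
    F.card * ENNReal.ofReal (N : ℝ)⁻¹ ≤ volume U := by
  have hN : (0 : ℝ) < N := by exact_mod_cast NeZero.pos N
  have hN1 : (N : ℝ)⁻¹ ≤ 1 := inv_le_one_of_one_le₀ (by exact_mod_cast NeZero.one_le)
  have hball : ∀ j : ZMod N, volume (Metric.ball (ZMod.toAddCircle j) ((N : ℝ)⁻¹ / 2))
      = ENNReal.ofReal (N : ℝ)⁻¹ := fun j => by
    rw [← measure_congr AddCircle.closedBall_ae_eq_ball, AddCircle.volume_closedBall,
      mul_div_cancel₀ _ two_ne_zero, min_eq_right hN1]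
  calc F.card * ENNReal.ofReal (N : ℝ)⁻¹
      = ∑ j ∈ F, volume (Metric.ball (ZMod.toAddCircle j) ((N : ℝ)⁻¹ / 2)) := by
        simp [hball]
    _ = volume (⋃ j ∈ F, Metric.ball (ZMod.toAddCircle j) ((N : ℝ)⁻¹ / 2)) := by
        refine (measure_biUnion_finset (fun i _ j _ hij => ?_) fun j _ =>
          Metric.isOpen_ball.measurableSet).symm
        refine Metric.ball_disjoint_ball ?_
        rw [add_halves]
        exact ZMod.inv_le_dist_toAddCircle hij
    _ ≤ volume U := measure_mono (Set.iUnion₂_subset hU)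

theorem ZMod.exists_dist_toAddCircle_le {N : ℕ} [NeZero N] (x : UnitAddCircle) :
    ∃ j : ZMod N, dist x (ZMod.toAddCircle j) ≤ (N : ℝ)⁻¹ / 2 := by
  have hN : (0 : ℝ) < N := by exact_mod_cast NeZero.pos N
  obtain ⟨x, rfl⟩ := QuotientAddGroup.mk_surjective x
  refine ⟨(round (x * N) : ℤ), ?_⟩
  rw [ZMod.toAddCircle_intCast, dist_eq_norm]
  refine (QuotientAddGroup.norm_mk_le_norm (m := x - (round (x * N) : ℝ) / N)).trans ?_
  have := abs_sub_round (x * N)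
  have e : x - (round (x * N) : ℝ) / N = (x * N - round (x * N)) * (N : ℝ)⁻¹ := by
    field_simp
  rw [Real.norm_eq_abs, e, abs_mul, abs_of_pos (inv_pos.2 hN)]
  nlinarith [inv_pos.2 hN]

/-- The Raikov inequality on the circle, for compact sets of small measure. -/
theorem UnitAddCircle.volume_add_volume_le {X Y : Set UnitAddCircle} (hX : IsCompact X)
    (hY : IsCompact Y) (hX0 : X.Nonempty) (hY0 : Y.Nonempty) (hXY : volume X + volume Y ≤ 1) :
    volume X + volume Y ≤ volume (X + Y) := by
  classical
  have hC : IsCompact (X + Y) := hX.add hY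
  have key : ∀ p : ℕ, p.Prime → volume X + volume Y ≤
      volume (Metric.cthickening (2 * (p : ℝ)⁻¹) (X + Y)) + ENNReal.ofReal (p : ℝ)⁻¹ := by
    intro p hp
    have : NeZero p := ⟨hp.ne_zero⟩
    have hp0 : (0 : ℝ) < p := by exact_mod_cast hp.pos
    have hp1 : (p : ℝ)⁻¹ ≤ 1 := inv_le_one_of_one_le₀ (by exact_mod_cast hp.one_le)
    let D : Set UnitAddCircle → Finset (ZMod p) := fun Z =>
      Finset.univ.filter fun j => ∃ x ∈ Z, dist x (ZMod.toAddCircle j) ≤ (p : ℝ)⁻¹ / 2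
    have hD : ∀ Z, volume Z ≤ (D Z).card * ENNReal.ofReal (p : ℝ)⁻¹ := by
      intro Z
      calc volume Z ≤ volume (⋃ j ∈ D Z, Metric.closedBall (ZMod.toAddCircle j) ((p : ℝ)⁻¹ / 2)) := by
            refine measure_mono fun x hx => ?_
            obtain ⟨j, hj⟩ := ZMod.exists_dist_toAddCircle_le (N := p) x
            exact Set.mem_biUnion (show j ∈ D Z by simpa [D] using ⟨x, hx, hj⟩) hj
        _ ≤ ∑ j ∈ D Z, volume (Metric.closedBall (ZMod.toAddCircle j) ((p : ℝ)⁻¹ / 2)) :=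
            measure_biUnion_finset_le _ _
        _ = _ := by
            simp [AddCircle.volume_closedBall, mul_div_cancel₀ _ (two_ne_zero (α := ℝ)), hp1]
    have hDn : ∀ Z : Set UnitAddCircle, Z.Nonempty → (D Z).Nonempty := by
      rintro Z ⟨x, hx⟩
      obtain ⟨j, hj⟩ := ZMod.exists_dist_toAddCircle_le (N := p) x
      exact ⟨j, by simpa [D] using ⟨x, hx, hj⟩⟩
    have hvol := ZMod.card_mul_inv_le_volume (D X + D Y)
      (U := Metric.cthickening (2 * (p : ℝ)⁻¹) (X + Y)) (by
        intro j hj z hz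
        obtain ⟨j₁, h₁, j₂, h₂, rfl⟩ := Finset.mem_add.1 hj
        obtain ⟨x, hx, hxj⟩ := (Finset.mem_filter.1 h₁).2
        obtain ⟨y, hy, hyj⟩ := (Finset.mem_filter.1 h₂).2
        refine Metric.mem_cthickening_of_dist_le z (x + y) _ _ (Set.add_mem_add hx hy) ?_
        rw [map_add] at hz
        have h3 := dist_add_add_le x y (ZMod.toAddCircle j₁) (ZMod.toAddCircle j₂)
        have h4 := dist_triangle z (ZMod.toAddCircle j₁ + ZMod.toAddCircle j₂) (x + y)
        rw [dist_comm (ZMod.toAddCircle j₁ + ZMod.toAddCircle j₂) (x + y)] at h4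
        have h5 := Metric.mem_ball.1 hz
        have := inv_pos.2 hp0
        linarith)
    rcases min_le_iff.1 (ZMod.cauchy_davenport hp (hDn X hX0) (hDn Y hY0)) with h | h
    · refine hXY.trans (le_add_right (le_trans ?_ hvol))
      calc (1 : ℝ≥0∞) = p * ENNReal.ofReal (p : ℝ)⁻¹ := by
            rw [ENNReal.ofReal_inv_of_pos hp0, ENNReal.ofReal_natCast,
              ENNReal.mul_inv_cancel (by exact_mod_cast hp.ne_zero) (ENNReal.natCast_ne_top p)]
        _ ≤ _ := by gcongr
    · calc volume X + volume Y
          ≤ ((D X).card + (D Y).card : ℝ≥0∞) * ENNReal.ofReal (p : ℝ)⁻¹ := by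
            rw [add_mul]
            exact add_le_add (hD X) (hD Y)
        _ ≤ ((D X + D Y).card + 1 : ℝ≥0∞) * ENNReal.ofReal (p : ℝ)⁻¹ := by
            refine mul_le_mul_left ?_ _
            exact_mod_cast (show (D X).card + (D Y).card ≤ (D X + D Y).card + 1 by omega)
        _ ≤ _ := by
            rw [add_mul, one_mul]
            gcongr
  have hinv : Filter.Tendsto (fun n : ℕ => ((Nat.nth Nat.Prime n : ℕ) : ℝ)⁻¹) Filter.atTop
      (nhds 0) :=
    (tendsto_inv_atTop_nhds_zero_nat (𝕜 := ℝ)).comp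
      (Nat.nth_strictMono Nat.infinite_setOfPred_prime).tendsto_atTop
  have lim : Filter.Tendsto (fun n : ℕ =>
      volume (Metric.cthickening (2 * ((Nat.nth Nat.Prime n : ℕ) : ℝ)⁻¹) (X + Y))
        + ENNReal.ofReal ((Nat.nth Nat.Prime n : ℕ) : ℝ)⁻¹) Filter.atTop
      (nhds (volume (X + Y) + ENNReal.ofReal 0)) := by
    refine Filter.Tendsto.add ?_ (ENNReal.tendsto_ofReal hinv)
    refine (tendsto_measure_cthickening_of_isCompact hC).comp ?_
    simpa using hinv.const_mul 2
  rw [ENNReal.ofReal_zero, add_zero] at lim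
  exact ge_of_tendsto' lim fun n => key _ (Nat.prime_nth_prime n)

/-- The lower bound for the volume of a sum of sets of volumes `a` and `b` in dimension `n + 1`
given by the Brunn–Minkowski inequality. -/
noncomputable def brunnMinkowskiBound (n : ℕ) (a b : ℝ) : ℝ :=
  (a ^ ((n + 1 : ℝ)⁻¹) + b ^ ((n + 1 : ℝ)⁻¹)) ^ (n + 1)

namespace brunnMinkowskiBound

variable {n : ℕ} {a b a' b' c : ℝ}

theorem comm (n : ℕ) (a b : ℝ) : brunnMinkowskiBound n a b = brunnMinkowskiBound n b a := by
  rw [brunnMinkowskiBound, brunnMinkowskiBound, add_comm]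

theorem zero_right (ha : 0 ≤ a) : brunnMinkowskiBound n a 0 = a := by
  rw [brunnMinkowskiBound, Real.zero_rpow (by positivity), add_zero]
  have := Real.rpow_inv_natCast_pow ha (n := n + 1) (by simp)
  push_cast at this
  exact this

theorem zero_left (hb : 0 ≤ b) : brunnMinkowskiBound n 0 b = b := by
  rw [comm, zero_right hb]

theorem mono (ha : 0 ≤ a) (hb : 0 ≤ b) (haa : a ≤ a') (hbb : b ≤ b') :
    brunnMinkowskiBound n a b ≤ brunnMinkowskiBound n a' b' := by
  unfold brunnMinkowskiBound
  gcongr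

theorem mul_left (hc : 0 ≤ c) (ha : 0 ≤ a) (hb : 0 ≤ b) :
    brunnMinkowskiBound n (c * a) (c * b) = c * brunnMinkowskiBound n a b := by
  unfold brunnMinkowskiBound
  rw [Real.mul_rpow hc ha, Real.mul_rpow hc hb, ← mul_add, mul_pow]
  congr 1
  have := Real.rpow_inv_natCast_pow hc (n := n + 1) (by simp)
  push_cast at this
  exact this

theorem pow_pow (ha : 0 ≤ a) (hb : 0 ≤ b) :
    brunnMinkowskiBound n (a ^ (n + 1)) (b ^ (n + 1)) = (a + b) ^ (n + 1) := by
  unfold brunnMinkowskiBound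
  have h := Real.pow_rpow_inv_natCast ha (n := n + 1) (by simp)
  have h' := Real.pow_rpow_inv_natCast hb (n := n + 1) (by simp)
  push_cast at h h'
  rw [h, h']

theorem add_le (ha : 0 ≤ a) (hb : 0 ≤ b) (ha' : 0 ≤ a') (hb' : 0 ≤ b') :
    brunnMinkowskiBound n a b + brunnMinkowskiBound n a' b' ≤
      brunnMinkowskiBound n (a + a') (b + b') := by
  set r : ℝ := (n + 1 : ℝ)⁻¹ with hr
  have hrp : ∀ {x : ℝ}, 0 ≤ x → (x ^ r) ^ (n + 1 : ℝ) = x := fun {x} hx => by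
    rw [← Real.rpow_mul hx, hr, inv_mul_cancel₀ (by positivity), Real.rpow_one]
  have hrp' : ∀ {x : ℝ}, 0 ≤ x → (x ^ (n + 1 : ℝ)) ^ r = x := fun {x} hx => by
    rw [← Real.rpow_mul hx, hr, mul_inv_cancel₀ (by positivity), Real.rpow_one]
  have key := Real.Lp_add_le_of_nonneg (Finset.univ : Finset (Fin 2)) (p := (n + 1 : ℝ))
    (f := ![a ^ r, a' ^ r]) (g := ![b ^ r, b' ^ r]) (by simp)
    (by intro i _; fin_cases i <;> simp <;> positivity)
    (by intro i _; fin_cases i <;> simp <;> positivity)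
  simp only [Fin.sum_univ_two, Matrix.cons_val_zero, Matrix.cons_val_one, one_div,
    hrp ha, hrp ha', hrp hb, hrp hb'] at key
  have h1 := Real.rpow_le_rpow (by positivity) key (show (0 : ℝ) ≤ n + 1 by positivity)
  rw [hrp (by positivity)] at h1
  unfold brunnMinkowskiBound
  rw [← hr, ← Real.rpow_natCast, ← Real.rpow_natCast, ← Real.rpow_natCast]
  push_cast
  exact h1

theorem add_le_self (ha : 0 ≤ a) (hb : 0 ≤ b) : a + b ≤ brunnMinkowskiBound n a b := by
  have := add_le (n := n) ha le_rfl le_rfl hb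
  rwa [zero_right ha, zero_left hb, zero_add, add_zero] at this

theorem add_left_le (ha : 0 ≤ a) (hb : 0 ≤ b) (hb' : 0 ≤ b') :
    brunnMinkowskiBound n a (b + b') + a ≤
      brunnMinkowskiBound n a b + brunnMinkowskiBound n a b' := by
  rcases (add_nonneg hb hb').eq_or_lt with h0 | h0
  · have : b = 0 := by linarith
    have : b' = 0 := by linarith
    subst b b'
    simp [zero_right ha]
  have h : ∀ {u v : ℝ}, 0 ≤ u → 0 ≤ v → u + v = b + b' →
      (u / (b + b')) * brunnMinkowskiBound n a (b + b') + (v / (b + b')) * a ≤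
        brunnMinkowskiBound n a u := by
    intro u v hu hv huv
    have hu' : 0 ≤ u / (b + b') := by positivity
    have hv' : 0 ≤ v / (b + b') := by positivity
    rw [← mul_left hu' ha h0.le]
    nth_rw 2 [← zero_right (n := n) ha]
    rw [← mul_left hv' ha le_rfl]
    refine (add_le (by positivity) (by positivity) (by positivity) (by simp)).trans (le_of_eq ?_)
    congr 1
    · rw [← add_mul, ← add_div, huv, div_self h0.ne', one_mul]
    · field_simp
      simp
  have h1 := h hb hb' rfl
  have h2 := h hb' hb (add_comm _ _)
  have e : b / (b + b') + b' / (b + b') = 1 := by rw [← add_div, div_self h0.ne']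
  have e2 : b' / (b + b') = 1 - b / (b + b') := by linarith
  rw [e2] at h1 h2
  linarith

theorem add_min_le_of_ratio_le {k₁ k₂ l₁ l₂ : ℝ} (hk : k₂ ≤ k₁) (hk₂ : 0 ≤ k₂)
    (hl : l₂ ≤ l₁) (hl₂ : 0 ≤ l₂) (hk₁ : 0 < k₁) (hl₁ : 0 < l₁) (hr : k₂ * l₁ ≤ k₁ * l₂) :
    brunnMinkowskiBound n (k₁ + k₂) (l₁ + l₂) + min (k₁ + k₂) (l₁ + l₂) ≤
      brunnMinkowskiBound n k₁ l₁ + brunnMinkowskiBound n k₁ l₂ + brunnMinkowskiBound n k₂ l₂ := by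
  set k := k₁ + k₂ with hkd
  set l := l₁ + l₂ with hld
  have hk0 : 0 < k := by linarith
  have hl0 : 0 < l := by linarith
  set x := k₂ / k with hx
  have hx0 : 0 ≤ x := by positivity
  have hxk : x * k = k₂ := by rw [hx]; field_simp
  have hxl : x * l ≤ l₂ := by
    rw [hx, div_mul_eq_mul_div, div_le_iff₀ hk0, hkd, hld]
    nlinarith
  have hx2 : 0 ≤ 1 - 2 * x := by
    have : x ≤ 1 / 2 := by
      rw [hx, div_le_iff₀ hk0]
      linarith
    linarith
  have hxl1 : x * l ≤ l₁ := hxl.trans hl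
  have e1 : x * brunnMinkowskiBound n k l + brunnMinkowskiBound n ((1 - 2 * x) * k) (l₁ - x * l)
      ≤ brunnMinkowskiBound n k₁ l₁ := by
    rw [← mul_left hx0 hk0.le hl0.le]
    refine (add_le (by positivity) (by positivity) (by positivity) (by linarith)).trans
      (le_of_eq ?_)
    congr 1 <;> linarith
  have e2 : x * brunnMinkowskiBound n k l + brunnMinkowskiBound n ((1 - 2 * x) * k) (l₂ - x * l)
      ≤ brunnMinkowskiBound n k₁ l₂ := by
    rw [← mul_left hx0 hk0.le hl0.le]
    refine (add_le (by positivity) (by positivity) (by positivity) (by linarith)).trans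
      (le_of_eq ?_)
    congr 1 <;> linarith
  have e3 : x * brunnMinkowskiBound n k l ≤ brunnMinkowskiBound n k₂ l₂ := by
    rw [← mul_left hx0 hk0.le hl0.le]
    exact mono (by positivity) (by positivity) hxk.le hxl
  have e4 := add_left_le (n := n) (show 0 ≤ (1 - 2 * x) * k by positivity)
    (show 0 ≤ l₁ - x * l by linarith) (show 0 ≤ l₂ - x * l by linarith)
  rw [show l₁ - x * l + (l₂ - x * l) = (1 - 2 * x) * l by linarith,
    mul_left hx2 hk0.le hl0.le] at e4
  have e5 := add_le_self (n := n) hk0.le hl0.le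
  have m1 := min_le_left k l
  have m2 := min_le_right k l
  have e6 : x * (2 * min k l) ≤ x * brunnMinkowskiBound n k l := by
    gcongr
    linarith
  have e7 : (1 - 2 * x) * min k l ≤ (1 - 2 * x) * k := by gcongr
  linarith

end brunnMinkowskiBound

theorem lintegral_comp_smul {n : ℕ} {p : ℝ} (hp : 0 < p) (f : (Fin n → ℝ) → ℝ≥0∞) :
    ∫⁻ x, f (p • x) = ENNReal.ofReal ((p ^ n)⁻¹) * ∫⁻ x, f x := by
  have e : ⇑(MeasurableEquiv.smul₀ p hp.ne' : (Fin n → ℝ) ≃ᵐ (Fin n → ℝ)) = fun x => p • x := rfl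
  have h := lintegral_map_equiv (μ := volume) f (MeasurableEquiv.smul₀ p hp.ne')
  rw [e, Measure.map_addHaar_smul volume hp.ne', lintegral_smul_measure] at h
  rw [← h]
  simp [abs_of_pos hp]

/-- A form of the Borell–Brascamp–Lieb inequality. -/
theorem ofReal_brunnMinkowskiBound_le_lintegral {n : ℕ} {f g h : (Fin n → ℝ) → ℝ≥0∞}
    (hf : Measurable f) (hg : Measurable g) (hh : Measurable h) {a b : ℝ} (ha : 0 < a)
    (hb : 0 < b) (hfa : ∫⁻ x, f x = ENNReal.ofReal a) (hgb : ∫⁻ x, g x = ENNReal.ofReal b)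
    (H : ∀ x y, f x ≠ 0 → g y ≠ 0 → f x + g y ≤ h (x + y)) :
    ENNReal.ofReal (brunnMinkowskiBound n a b) ≤ ∫⁻ x, h x := by
  set α := a ^ ((n + 1 : ℝ)⁻¹) with hα
  set β := b ^ ((n + 1 : ℝ)⁻¹) with hβ
  have hα0 : 0 < α := by positivity
  have hβ0 : 0 < β := by positivity
  have hαa : α ^ (n + 1) = a := by
    have := Real.rpow_inv_natCast_pow ha.le (n := n + 1) (by simp)
    push_cast at this
    exact this
  have hβb : β ^ (n + 1) = b := by
    have := Real.rpow_inv_natCast_pow hb.le (n := n + 1) (by simp)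
    push_cast at this
    exact this
  set p := α / (α + β) with hp
  set q := β / (α + β) with hq
  have hp0 : 0 < p := by positivity
  have hq0 : 0 < q := by positivity
  have hpq : p + q = 1 := by rw [hp, hq]; field_simp
  set M := brunnMinkowskiBound n a b with hM
  have hint : ∀ {u : (Fin n → ℝ) → ℝ≥0∞} {γ c r : ℝ}, 0 < γ → γ ^ (n + 1) = c →
      r = γ / (α + β) → ∫⁻ x, u x = ENNReal.ofReal c →
      ∫⁻ x, u (r • x) / ENNReal.ofReal r = ENNReal.ofReal M := by
    intro u γ c r hγ hc hr hu
    have hr0 : 0 < r := by rw [hr]; positivity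
    simp only [div_eq_mul_inv]
    rw [lintegral_mul_const' _ _ (by simp [hr0]), lintegral_comp_smul hr0, hu,
      ← ENNReal.ofReal_inv_of_pos hr0, ← ENNReal.ofReal_mul (by positivity : (0 : ℝ) ≤ (r ^ n)⁻¹),
      ← ENNReal.ofReal_mul (by rw [← hc]; positivity), ← hc, hM, brunnMinkowskiBound, ← hα, ← hβ,
      hr, div_pow]
    congr 1
    have : α + β ≠ 0 := by positivity
    field_simp
    ring
  have key := prekopaLeindler hp0 hq0 hpq
    (f := fun x => f (p • x) / ENNReal.ofReal p) (g := fun x => g (q • x) / ENNReal.ofReal q)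
    (h := h) ((hf.comp (measurable_const_smul p)).div_const _)
    ((hg.comp (measurable_const_smul q)).div_const _) hh (by
      intro x y
      by_cases hfx : f (p • x) = 0
      · simp [hfx, hp0]
      by_cases hgy : g (q • y) = 0
      · simp [hgy, hq0]
      refine (ENNReal.geom_mean_le_arith_mean2 hp0 hq0 hpq _ _).trans
        (le_trans (le_of_eq ?_) (H _ _ hfx hgy))
      rw [ENNReal.mul_div_cancel (by simpa using hp0) ENNReal.ofReal_ne_top,
        ENNReal.mul_div_cancel (by simpa using hq0) ENNReal.ofReal_ne_top])
  rw [hint hα0 hαa hp hfa, hint hβ0 hβb hq hgb,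
    ← ENNReal.rpow_add_of_nonneg _ _ hp0.le hq0.le, hpq, ENNReal.rpow_one] at key
  exact key

/-- The Brunn–Minkowski inequality on a cylinder, for sets whose fibres over the linear factor
are short. -/
theorem ofReal_brunnMinkowskiBound_le_volume_cylinder {n : ℕ}
    {P Q : Set (UnitAddCircle × (Fin n → ℝ))} (hP : IsCompact P) (hQ : IsCompact Q)
    (hP0 : P.Nonempty) (hQ0 : Q.Nonempty)
    (hPf : ∀ y, volume ((fun s => (s, y)) ⁻¹' P) ≤ 1 / 2)
    (hQf : ∀ y, volume ((fun s => (s, y)) ⁻¹' Q) ≤ 1 / 2) :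
    ENNReal.ofReal (brunnMinkowskiBound n (volume P).toReal (volume Q).toReal) ≤
      volume (P + Q) := by
  have : (volume : Measure (UnitAddCircle × (Fin n → ℝ))).IsAddLeftInvariant := by
    rw [Measure.volume_eq_prod]
    infer_instance
  have hPt : volume P ≠ ∞ := hP.measure_lt_top.ne
  have hQt : volume Q ≠ ∞ := hQ.measure_lt_top.ne
  by_cases hP00 : volume P = 0
  · obtain ⟨z, hz⟩ := hP0
    rw [hP00, ENNReal.toReal_zero, brunnMinkowskiBound.zero_left ENNReal.toReal_nonneg,
      ENNReal.ofReal_toReal hQt, ← measure_vadd volume z Q]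
    exact measure_mono (by rintro _ ⟨w, hw, rfl⟩; exact Set.add_mem_add hz hw)
  by_cases hQ00 : volume Q = 0
  · obtain ⟨z, hz⟩ := hQ0
    rw [hQ00, ENNReal.toReal_zero, brunnMinkowskiBound.zero_right ENNReal.toReal_nonneg,
      ENNReal.ofReal_toReal hPt, ← measure_vadd volume z P, add_comm P Q]
    exact measure_mono (by rintro _ ⟨w, hw, rfl⟩; exact Set.add_mem_add hz hw)
  have fib : ∀ {R : Set (UnitAddCircle × (Fin n → ℝ))}, IsCompact R →
      volume R = ∫⁻ y, volume ((fun s => (s, y)) ⁻¹' R) := fun {R} hR => by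
    rw [Measure.volume_eq_prod, Measure.prod_apply_symm hR.measurableSet]
  have fibc : ∀ {R : Set (UnitAddCircle × (Fin n → ℝ))} (y), IsCompact R →
      IsCompact ((fun s => (s, y)) ⁻¹' R) := fun y hR =>
    (hR.isClosed.preimage (by fun_prop)).isCompact
  rw [fib (hP.add hQ)]
  refine ofReal_brunnMinkowskiBound_le_lintegral
    (f := fun y => volume ((fun s => (s, y)) ⁻¹' P))
    (g := fun y => volume ((fun s => (s, y)) ⁻¹' Q))
    (measurable_measure_prodMk_right hP.measurableSet)
    (measurable_measure_prodMk_right hQ.measurableSet)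
    (measurable_measure_prodMk_right (hP.add hQ).measurableSet)
    (ENNReal.toReal_pos hP00 hPt) (ENNReal.toReal_pos hQ00 hQt)
    (by rw [ENNReal.ofReal_toReal hPt, fib hP]) (by rw [ENNReal.ofReal_toReal hQt, fib hQ])
    fun x y hx hy => ?_
  refine (UnitAddCircle.volume_add_volume_le (fibc x hP) (fibc y hQ)
    (nonempty_of_measure_ne_zero hx) (nonempty_of_measure_ne_zero hy)
    ((add_le_add (hPf x) (hQf y)).trans (by simp [ENNReal.inv_two_add_inv_two]))).trans
    (measure_mono ?_)
  rintro _ ⟨s, hs, s', hs', rfl⟩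
  exact ⟨(s, x), hs, (s', y), hs', rfl⟩

theorem lintegral_Ioc_tsum_zmultiples {X : Set ℝ} (hX : MeasurableSet X) :
    ∫⁻ z in Set.Ioc (0 : ℝ) (0 + 1), ∑' g : AddSubgroup.zmultiples (1 : ℝ),
      X.indicator (fun _ => (1 : ℝ≥0∞)) (g + z) = volume X := by
  have hm : Measurable (X.indicator fun _ => (1 : ℝ≥0∞)) := measurable_const.indicator hX
  rw [lintegral_tsum fun g => (show Measurable fun z : ℝ => X.indicator (fun _ => (1 : ℝ≥0∞))
    ((g : AddSubgroup.zmultiples (1 : ℝ)) + z) from hm.comp (measurable_const_add _)).aemeasurable,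
    ← lintegral_indicator_one hX]
  exact ((isAddFundamentalDomain_Ioc one_pos 0).lintegral_eq_tsum'' _).symm

theorem lintegral_Ioc_indicator_coe_image {T : Set ℝ} (hT : IsCompact T) :
    ∫⁻ z in Set.Ioc (0 : ℝ) (0 + 1), ((fun s : ℝ => (s : UnitAddCircle)) ⁻¹'
      ((fun s : ℝ => (s : UnitAddCircle)) '' T)).indicator (fun _ => (1 : ℝ≥0∞)) z =
      volume ((fun s : ℝ => (s : UnitAddCircle)) '' T) := by
  have hc : IsCompact ((fun s : ℝ => (s : UnitAddCircle)) '' T) :=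
    hT.image (AddCircle.continuous_mk' 1)
  have hm : MeasurableSet ((fun s : ℝ => (s : UnitAddCircle)) ⁻¹'
      ((fun s : ℝ => (s : UnitAddCircle)) '' T)) :=
    (AddCircle.continuous_mk' 1).measurable hc.measurableSet
  rw [AddCircle.add_projection_respects_measure (T := 1) 0 hc.measurableSet]
  rw [← Measure.restrict_apply hm]
  exact lintegral_indicator_one hm

theorem coe_mem_image_coe_iff {T : Set ℝ} {z : ℝ} :
    z ∈ (fun s : ℝ => (s : UnitAddCircle)) ⁻¹' ((fun s : ℝ => (s : UnitAddCircle)) '' T) ↔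
      ∃ g : AddSubgroup.zmultiples (1 : ℝ), g + z ∈ T := by
  constructor
  · rintro ⟨s, hs, hsz⟩
    have := (QuotientAddGroup.eq (s := AddSubgroup.zmultiples (1 : ℝ))).1 hsz.symm
    exact ⟨⟨_, this⟩, by simpa using hs⟩
  · rintro ⟨g, hg⟩
    refine ⟨_, hg, ?_⟩
    refine (QuotientAddGroup.eq (s := AddSubgroup.zmultiples (1 : ℝ))).2 ?_
    have : -((g : ℝ) + z) + z = -g := by ring
    rw [this]
    exact neg_mem g.2

open Classical in
theorem indicator_coe_image_apply {T : Set ℝ} {z : ℝ} :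
    ((fun s : ℝ => (s : UnitAddCircle)) ⁻¹'
      ((fun s : ℝ => (s : UnitAddCircle)) '' T)).indicator (fun _ => (1 : ℝ≥0∞)) z =
      if ∃ g : AddSubgroup.zmultiples (1 : ℝ), g + z ∈ T then 1 else 0 := by
  rw [Set.indicator_apply]
  exact if_congr coe_mem_image_coe_iff rfl rfl

theorem volume_coe_image_add_le {X T₁ T₂ T₃ : Set ℝ} (hX : MeasurableSet X) (h₁ : IsCompact T₁)
    (h₂ : IsCompact T₂) (h₃ : IsCompact T₃) (h₁X : T₁ ⊆ X) (h₂X : ∀ s ∈ T₂, s ∈ X ∧ s + 1 ∈ X)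
    (h₃X : ∀ s ∈ T₃, s ∈ X ∧ s + 1 ∈ X ∧ s + 2 ∈ X) (h₂₁ : T₂ ⊆ T₁) (h₃₂ : T₃ ⊆ T₂) :
    volume ((fun s : ℝ => (s : UnitAddCircle)) '' T₁) +
      volume ((fun s : ℝ => (s : UnitAddCircle)) '' T₂) +
      volume ((fun s : ℝ => (s : UnitAddCircle)) '' T₃) ≤ volume X := by
  have hm : ∀ {T : Set ℝ}, IsCompact T → Measurable (((fun s : ℝ => (s : UnitAddCircle)) ⁻¹'
      ((fun s : ℝ => (s : UnitAddCircle)) '' T)).indicator (fun _ => (1 : ℝ≥0∞))) := fun hT =>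
    measurable_const.indicator ((AddCircle.continuous_mk' 1).measurable
      (hT.image (AddCircle.continuous_mk' 1)).measurableSet)
  rw [← lintegral_Ioc_indicator_coe_image h₁, ← lintegral_Ioc_indicator_coe_image h₂,
    ← lintegral_Ioc_indicator_coe_image h₃, ← lintegral_Ioc_tsum_zmultiples hX,
    ← lintegral_add_left (hm h₁), ← lintegral_add_left (by exact (hm h₁).add (hm h₂))]
  refine lintegral_mono fun z => ?_
  simp only [indicator_coe_image_apply]
  let e : AddSubgroup.zmultiples (1 : ℝ) := ⟨1, AddSubgroup.mem_zmultiples 1⟩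
  have he : (e : ℝ) = 1 := rfl
  have hadd : ∀ g : AddSubgroup.zmultiples (1 : ℝ),
      ((g + e : AddSubgroup.zmultiples (1 : ℝ)) : ℝ) + z = g + z + 1 := fun g => by
    rw [AddSubgroup.coe_add, he]
    ring
  have hne : ∀ g : AddSubgroup.zmultiples (1 : ℝ), g ≠ g + e := fun g h => by
    have := congrArg (Subtype.val) h
    simp [he] at this
  have hne2 : ∀ g : AddSubgroup.zmultiples (1 : ℝ), g ≠ g + e + e := fun g h => by
    have := congrArg (Subtype.val) h
    simp only [AddSubgroup.coe_add, he] at this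
    linarith
  by_cases c₃ : ∃ g : AddSubgroup.zmultiples (1 : ℝ), g + z ∈ T₃
  · have c₂ : ∃ g : AddSubgroup.zmultiples (1 : ℝ), g + z ∈ T₂ := c₃.imp fun g hg => h₃₂ hg
    have c₁ : ∃ g : AddSubgroup.zmultiples (1 : ℝ), g + z ∈ T₁ := c₂.imp fun g hg => h₂₁ hg
    obtain ⟨g, hg⟩ := c₃
    refine le_trans ?_ (ENNReal.sum_le_tsum {g, g + e, g + e + e})
    obtain ⟨m₁, m₂, m₃⟩ := h₃X _ hg
    rw [Finset.sum_insert (by simpa only [Finset.mem_insert, Finset.mem_singleton, not_or] using ⟨hne g, hne2 g⟩), Finset.sum_insert (by simpa only [Finset.mem_singleton] using hne _),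
      Finset.sum_singleton]
    rw [if_pos c₁, if_pos c₂, if_pos ⟨g, hg⟩, Set.indicator_of_mem m₁, Set.indicator_of_mem,
      Set.indicator_of_mem, add_assoc]
    · rw [hadd, hadd, add_assoc _ (1 : ℝ) 1, one_add_one_eq_two]
      exact m₃
    · rw [hadd]
      exact m₂
  by_cases c₂ : ∃ g : AddSubgroup.zmultiples (1 : ℝ), g + z ∈ T₂
  · have c₁ : ∃ g : AddSubgroup.zmultiples (1 : ℝ), g + z ∈ T₁ := c₂.imp fun g hg => h₂₁ hg
    obtain ⟨g, hg⟩ := c₂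
    refine le_trans ?_ (ENNReal.sum_le_tsum {g, g + e})
    obtain ⟨m₁, m₂⟩ := h₂X _ hg
    rw [Finset.sum_insert (by simpa only [Finset.mem_singleton] using hne _), Finset.sum_singleton]
    rw [if_pos c₁, if_pos ⟨g, hg⟩, if_neg c₃, Set.indicator_of_mem m₁, Set.indicator_of_mem,
      add_zero]
    rw [hadd]
    exact m₂
  by_cases c₁ : ∃ g : AddSubgroup.zmultiples (1 : ℝ), g + z ∈ T₁
  · obtain ⟨g, hg⟩ := c₁
    refine le_trans ?_ (ENNReal.le_tsum g)
    rw [if_pos ⟨g, hg⟩, if_neg c₂, if_neg c₃, Set.indicator_of_mem (h₁X hg)]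
    simp
  simp [if_neg c₁, if_neg c₂, if_neg c₃]

theorem volume_le_volume_coe_image_add {X : Set ℝ} (hX : IsCompact X)
    (hd : ∀ s ∈ X, ∀ s' ∈ X, s' - s < 2) :
    volume X ≤ volume ((fun s : ℝ => (s : UnitAddCircle)) '' X) +
      volume ((fun s : ℝ => (s : UnitAddCircle)) '' (X ∩ (fun s => s + 1) ⁻¹' X)) := by
  have hX2 : IsCompact (X ∩ (fun s => s + 1) ⁻¹' X) :=
    hX.inter_right (hX.isClosed.preimage (by fun_prop))
  have hm : ∀ {T : Set ℝ}, IsCompact T → Measurable (((fun s : ℝ => (s : UnitAddCircle)) ⁻¹'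
      ((fun s : ℝ => (s : UnitAddCircle)) '' T)).indicator (fun _ => (1 : ℝ≥0∞))) := fun hT =>
    measurable_const.indicator ((AddCircle.continuous_mk' 1).measurable
      (hT.image (AddCircle.continuous_mk' 1)).measurableSet)
  rw [← lintegral_Ioc_indicator_coe_image hX, ← lintegral_Ioc_indicator_coe_image hX2,
    ← lintegral_Ioc_tsum_zmultiples hX.measurableSet, ← lintegral_add_left (hm hX)]
  refine lintegral_mono fun z => ?_
  simp only [indicator_coe_image_apply]
  let e : AddSubgroup.zmultiples (1 : ℝ) := ⟨1, AddSubgroup.mem_zmultiples 1⟩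
  have he : (e : ℝ) = 1 := rfl
  have hadd : ∀ g : AddSubgroup.zmultiples (1 : ℝ),
      ((g + e : AddSubgroup.zmultiples (1 : ℝ)) : ℝ) + z = g + z + 1 := fun g => by
    rw [AddSubgroup.coe_add, he]
    ring
  by_cases c₁ : ∃ g : AddSubgroup.zmultiples (1 : ℝ), g + z ∈ X
  swap
  · push Not at c₁
    simp [Set.indicator_of_notMem (c₁ _)]
  rw [if_pos c₁]
  have step : ∀ g g' : AddSubgroup.zmultiples (1 : ℝ), g + z ∈ X → g' + z ∈ X → g < g' →
      g' = g + e := by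
    rintro ⟨_, m, rfl⟩ ⟨_, m', rfl⟩ h h' hlt
    have h1 := hd _ h _ h'
    have hlt' : (m : ℝ) < m' := by simpa using hlt
    simp at h1
    have h1' : (m' : ℝ) < m + 2 := by linarith
    have : m' = m + 1 := by
      have a1 : m < m' := by exact_mod_cast hlt'
      have a2 : m' < m + 2 := by exact_mod_cast h1'
      omega
    subst this
    ext
    simp [he]
  by_cases c₂ : ∃ g : AddSubgroup.zmultiples (1 : ℝ), (g : ℝ) + z ∈ X ∩ (fun s => s + 1) ⁻¹' X
  · rw [if_pos c₂]
    obtain ⟨g, hg, hg1⟩ := c₂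
    have hg1' : ((g + e : AddSubgroup.zmultiples (1 : ℝ)) : ℝ) + z ∈ X := by
      rw [hadd]
      exact hg1
    have hlt : g < g + e := by
      rw [← Subtype.coe_lt_coe]
      simp [he]
    rw [tsum_eq_sum (s := {g, g + e})]
    · rw [Finset.sum_insert (by simpa only [Finset.mem_singleton] using hlt.ne), Finset.sum_singleton]
      gcongr <;> exact Set.indicator_apply_le' (fun _ => le_rfl) (fun _ => zero_le)
    · intro g' hg'
      refine Set.indicator_of_notMem (fun hmem => hg' ?_) _
      rcases lt_trichotomy g g' with h | h | h
      · simp [step _ _ hg hmem h]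
      · simp [h]
      · have h1 := step _ _ hmem hg h
        have h2 := step _ _ hmem hg1' (h.trans hlt)
        exact absurd (h1.trans h2.symm) hlt.ne
  · rw [if_neg c₂, add_zero]
    obtain ⟨g, hg⟩ := c₁
    rw [tsum_eq_single g]
    · exact Set.indicator_apply_le' (fun _ => le_rfl) (fun _ => zero_le)
    · intro g' hne
      refine Set.indicator_of_notMem (fun hmem => c₂ ?_) _
      rcases lt_or_gt_of_ne hne with h | h
      · refine ⟨g', hmem, ?_⟩
        have := step _ _ hmem hg h
        rw [this, hadd] at hg
        exact hg
      · refine ⟨g, hg, ?_⟩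
        have := step _ _ hg hmem h
        rw [this, hadd] at hmem
        exact hmem

/-- The projection from `ℝ × ℝⁿ` to the cylinder `(ℝ / ℤ) × ℝⁿ`. -/
def toCylinder (n : ℕ) : ℝ × (Fin n → ℝ) → UnitAddCircle × (Fin n → ℝ) :=
  Prod.map (fun s : ℝ => (s : UnitAddCircle)) id

theorem continuous_toCylinder (n : ℕ) : Continuous (toCylinder n) :=
  (AddCircle.continuous_mk' 1).prodMap continuous_id

theorem toCylinder_add {n : ℕ} (p q : ℝ × (Fin n → ℝ)) :
    toCylinder n (p + q) = toCylinder n p + toCylinder n q := rfl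

theorem preimage_toCylinder_image {n : ℕ} (T : Set (ℝ × (Fin n → ℝ))) (y : Fin n → ℝ) :
    (fun s => (s, y)) ⁻¹' (toCylinder n '' T) =
      (fun s : ℝ => (s : UnitAddCircle)) '' ((fun s => (s, y)) ⁻¹' T) := by
  ext s
  constructor
  · rintro ⟨⟨s', y'⟩, h, h'⟩
    obtain ⟨rfl, rfl⟩ := Prod.ext_iff.1 h'
    exact ⟨s', h, rfl⟩
  · rintro ⟨s', h, rfl⟩
    exact ⟨_, h, rfl⟩

theorem isCompact_preimage_prodMk {α : Type*} [TopologicalSpace α] [T2Space α] {n : ℕ}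
    {T : Set (α × (Fin n → ℝ))} (hT : IsCompact T) (y : Fin n → ℝ) :
    IsCompact ((fun s => (s, y)) ⁻¹' T) :=
  (Topology.IsClosedEmbedding.of_continuous_injective_isClosedMap (by fun_prop)
    (Prod.mk_left_injective y) (fun Z hZ => by
      have : (fun s => (s, y)) '' Z = Z ×ˢ {y} := by
        ext ⟨s, y'⟩
        simp [eq_comm]
      rw [this]
      exact hZ.prod isClosed_singleton)).isCompact_preimage hT

theorem volume_toCylinder_image {n : ℕ} {T : Set (ℝ × (Fin n → ℝ))} (hT : IsCompact T) :
    volume (toCylinder n '' T) =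
      ∫⁻ y, volume ((fun s : ℝ => (s : UnitAddCircle)) '' ((fun s => (s, y)) ⁻¹' T)) := by
  rw [Measure.volume_eq_prod, Measure.prod_apply_symm
    (hT.image (continuous_toCylinder n)).measurableSet]
  simp only [preimage_toCylinder_image]

theorem measurable_volume_coe_image {n : ℕ} {T : Set (ℝ × (Fin n → ℝ))} (hT : IsCompact T) :
    Measurable fun y =>
      volume ((fun s : ℝ => (s : UnitAddCircle)) '' ((fun s => (s, y)) ⁻¹' T)) := by
  simp only [← preimage_toCylinder_image]
  exact measurable_measure_prodMk_right (hT.image (continuous_toCylinder n)).measurableSet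

theorem volume_toCylinder_image_add_le {n : ℕ} {S T₁ T₂ T₃ : Set (ℝ × (Fin n → ℝ))}
    (hS : IsCompact S) (h₁ : IsCompact T₁) (h₂ : IsCompact T₂) (h₃ : IsCompact T₃) (h₁S : T₁ ⊆ S)
    (h₂S : ∀ p ∈ T₂, p ∈ S ∧ (p.1 + 1, p.2) ∈ S)
    (h₃S : ∀ p ∈ T₃, p ∈ S ∧ (p.1 + 1, p.2) ∈ S ∧ (p.1 + 2, p.2) ∈ S)
    (h₂₁ : T₂ ⊆ T₁) (h₃₂ : T₃ ⊆ T₂) :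
    volume (toCylinder n '' T₁) + volume (toCylinder n '' T₂) + volume (toCylinder n '' T₃) ≤
      volume S := by
  rw [volume_toCylinder_image h₁, volume_toCylinder_image h₂, volume_toCylinder_image h₃,
    ← lintegral_add_left (measurable_volume_coe_image h₁),
    ← lintegral_add_left (by
      exact (measurable_volume_coe_image h₁).add (measurable_volume_coe_image h₂)),
    Measure.volume_eq_prod, Measure.prod_apply_symm hS.measurableSet]
  exact lintegral_mono fun y => volume_coe_image_add_le
    (isCompact_preimage_prodMk hS y).measurableSet (isCompact_preimage_prodMk h₁ y)
    (isCompact_preimage_prodMk h₂ y) (isCompact_preimage_prodMk h₃ y)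
    (fun s hs => h₁S hs) (fun s hs => h₂S _ hs) (fun s hs => h₃S _ hs)
    (fun s hs => h₂₁ hs) (fun s hs => h₃₂ hs)

theorem volume_le_volume_toCylinder_image_add {n : ℕ} {K : Set (ℝ × (Fin n → ℝ))}
    (hK : IsCompact K) (hd : ∀ p ∈ K, ∀ q ∈ K, p.2 = q.2 → q.1 - p.1 < 2) :
    volume K ≤ volume (toCylinder n '' K) +
      volume (toCylinder n '' (K ∩ (fun p => (p.1 + 1, p.2)) ⁻¹' K)) := by
  have h2 : IsCompact (K ∩ (fun p => (p.1 + 1, p.2)) ⁻¹' K) :=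
    hK.inter_right (hK.isClosed.preimage (by fun_prop))
  rw [volume_toCylinder_image hK, volume_toCylinder_image h2,
    ← lintegral_add_left (measurable_volume_coe_image hK),
    Measure.volume_eq_prod, Measure.prod_apply_symm hK.measurableSet]
  exact lintegral_mono fun y => volume_le_volume_coe_image_add (isCompact_preimage_prodMk hK y)
    fun s hs s' hs' => hd _ hs _ hs' rfl

theorem volume_coe_image_le {X : Set ℝ} (hX : IsCompact X) :
    volume ((fun s : ℝ => (s : UnitAddCircle)) '' X) ≤ volume X := by
  simpa using volume_coe_image_add_le hX.measurableSet hX isCompact_empty isCompact_empty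
    subset_rfl (by simp) (by simp) (by simp) (by simp)

/-- A stability version of the Brunn–Minkowski inequality: two sets with short fibres in a given
direction, one of which is long in that direction, have a large sumset. -/
theorem ofReal_brunnMinkowskiBound_add_min_le {n : ℕ} {K L : Set (ℝ × (Fin n → ℝ))}
    (hK : IsCompact K) (hL : IsCompact L) (hK0 : 0 < volume K) (hL0 : 0 < volume L)
    (hKd : ∀ p ∈ K, ∀ q ∈ K, p.2 = q.2 → q.1 - p.1 < 2)
    (hLd : ∀ p ∈ L, ∀ q ∈ L, p.2 = q.2 → q.1 - p.1 < 2)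
    (hKf : ∀ y, volume ((fun s => (s, y)) ⁻¹' K) ≤ 1 / 2)
    (hLf : ∀ y, volume ((fun s => (s, y)) ⁻¹' L) ≤ 1 / 2)
    (h : ∃ p ∈ L, (p.1 + 1, p.2) ∈ L) :
    ENNReal.ofReal (brunnMinkowskiBound n (volume K).toReal (volume L).toReal +
      min (volume K).toReal (volume L).toReal) ≤ volume (K + L) := by
  set sh : ℝ × (Fin n → ℝ) → ℝ × (Fin n → ℝ) := fun p => (p.1 + 1, p.2) with hsh
  have hshc : Continuous sh := by fun_prop
  set K₂ := K ∩ sh ⁻¹' K with hK₂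
  set L₂ := L ∩ sh ⁻¹' L with hL₂
  set S := K + L with hS
  set S₂ := S ∩ sh ⁻¹' S with hS₂
  set S₃ := S₂ ∩ sh ⁻¹' S₂ with hS₃
  have cK₂ : IsCompact K₂ := hK.inter_right (hK.isClosed.preimage hshc)
  have cL₂ : IsCompact L₂ := hL.inter_right (hL.isClosed.preimage hshc)
  have cS : IsCompact S := hK.add hL
  have cS₂ : IsCompact S₂ := cS.inter_right (cS.isClosed.preimage hshc)
  have cS₃ : IsCompact S₃ := cS₂.inter_right (cS₂.isClosed.preimage hshc)
  have ft : ∀ {T : Set (ℝ × (Fin n → ℝ))}, IsCompact T → volume (toCylinder n '' T) ≠ ∞ :=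
    fun hT => (hT.image (continuous_toCylinder n)).measure_lt_top.ne
  have hKl : L₂.Nonempty := h
  have hKne : K.Nonempty := nonempty_of_measure_ne_zero hK0.ne'
  have hLne : L.Nonempty := nonempty_of_measure_ne_zero hL0.ne'
  have bm : ∀ {P Q T : Set (ℝ × (Fin n → ℝ))}, IsCompact P → IsCompact Q → IsCompact T →
      P.Nonempty → Q.Nonempty → P ⊆ K → Q ⊆ L → P + Q ⊆ T →
      brunnMinkowskiBound n (volume (toCylinder n '' P)).toReal
        (volume (toCylinder n '' Q)).toReal ≤ (volume (toCylinder n '' T)).toReal := by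
    intro P Q T hP hQ hT hP0 hQ0 hPK hQL hPQ
    rw [← ENNReal.ofReal_le_iff_le_toReal (ft hT)]
    refine (ofReal_brunnMinkowskiBound_le_volume_cylinder (hP.image (continuous_toCylinder n))
      (hQ.image (continuous_toCylinder n)) (hP0.image _) (hQ0.image _) (fun y => ?_)
      (fun y => ?_)).trans (measure_mono ?_)
    · rw [preimage_toCylinder_image]
      exact (volume_coe_image_le (isCompact_preimage_prodMk hP y)).trans
        ((measure_mono (Set.preimage_mono hPK)).trans (hKf y))
    · rw [preimage_toCylinder_image]
      exact (volume_coe_image_le (isCompact_preimage_prodMk hQ y)).trans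
        ((measure_mono (Set.preimage_mono hQL)).trans (hLf y))
    · rintro _ ⟨_, ⟨p, hp, rfl⟩, _, ⟨q, hq, rfl⟩, rfl⟩
      exact ⟨p + q, hPQ (Set.add_mem_add hp hq), toCylinder_add p q⟩
  have shl : ∀ p q : ℝ × (Fin n → ℝ), sh (p + q) = sh p + q := fun p q => by
    ext <;> simp [hsh, add_right_comm]
  have shr : ∀ p q : ℝ × (Fin n → ℝ), sh (p + q) = p + sh q := fun p q => by
    ext <;> simp [hsh, add_assoc]
  have i12 : K + L₂ ⊆ S₂ := by
    rintro _ ⟨p, hp, q, hq, rfl⟩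
    exact ⟨Set.add_mem_add hp hq.1, by
      rw [Set.mem_preimage, shr]; exact Set.add_mem_add hp hq.2⟩
  have i21 : K₂ + L ⊆ S₂ := by
    rintro _ ⟨p, hp, q, hq, rfl⟩
    exact ⟨Set.add_mem_add hp.1 hq, by
      rw [Set.mem_preimage, shl]; exact Set.add_mem_add hp.2 hq⟩
  have i22 : K₂ + L₂ ⊆ S₃ := by
    rintro _ ⟨p, hp, q, hq, rfl⟩
    refine ⟨i12 (Set.add_mem_add hp.1 hq), ?_⟩
    rw [Set.mem_preimage, shl]
    exact i12 (Set.add_mem_add hp.2 hq)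
  have hsum := volume_toCylinder_image_add_le cS cS cS₂ cS₃ subset_rfl (fun p hp => hp)
    (fun p hp => ⟨hp.1.1, hp.1.2, by
      have h2 : sh (sh p) ∈ S := hp.2.2
      have e2 : sh (sh p) = (p.1 + 2, p.2) := by
        ext <;> simp [hsh, add_assoc, one_add_one_eq_two]
      rwa [e2] at h2⟩)
    Set.inter_subset_left Set.inter_subset_left
  have hk := volume_le_volume_toCylinder_image_add hK hKd
  have hl := volume_le_volume_toCylinder_image_add hL hLd
  have hk' := ENNReal.toReal_mono (ENNReal.add_ne_top.2 ⟨ft hK, ft cK₂⟩) hk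
  have hl' := ENNReal.toReal_mono (ENNReal.add_ne_top.2 ⟨ft hL, ft cL₂⟩) hl
  rw [ENNReal.toReal_add (ft hK) (ft cK₂)] at hk'
  rw [ENNReal.toReal_add (ft hL) (ft cL₂)] at hl'
  have hsum' := ENNReal.toReal_mono cS.measure_lt_top.ne hsum
  rw [ENNReal.toReal_add (by simp [ft cS, ft cS₂]) (ft cS₃), ENNReal.toReal_add (ft cS) (ft cS₂)]
    at hsum'
  have hK21 := ENNReal.toReal_mono (ft hK)
    (measure_mono (μ := volume) (Set.image_mono (f := toCylinder n)
      (Set.inter_subset_left : K₂ ⊆ K)))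
  have hL21 := ENNReal.toReal_mono (ft hL)
    (measure_mono (μ := volume) (Set.image_mono (f := toCylinder n)
      (Set.inter_subset_left : L₂ ⊆ L)))
  have b11 := bm hK hL cS hKne hLne subset_rfl subset_rfl subset_rfl
  have b12 := bm hK cL₂ cS₂ hKne hKl subset_rfl Set.inter_subset_left i12
  have hKp := ENNReal.toReal_pos hK0.ne' hK.measure_lt_top.ne
  have hLp := ENNReal.toReal_pos hL0.ne' hL.measure_lt_top.ne
  refine ENNReal.ofReal_le_of_le_toReal (le_trans ?_ hsum')
  have nn : ∀ T, 0 ≤ (volume (toCylinder n '' T)).toReal := fun T => ENNReal.toReal_nonneg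
  refine (add_le_add (brunnMinkowskiBound.mono hKp.le hLp.le hk' hl')
    (min_le_min hk' hl')).trans ?_
  rcases K₂.eq_empty_or_nonempty with hemp | hne
  · rw [hemp, Set.image_empty, measure_empty, ENNReal.toReal_zero, add_zero]
    have := brunnMinkowskiBound.add_left_le (n := n) (nn K) (nn L) (nn L₂)
    have m := min_le_left (volume (toCylinder n '' K)).toReal
      ((volume (toCylinder n '' L)).toReal + (volume (toCylinder n '' L₂)).toReal)
    have := nn S₃
    linarith
  have b21 := bm cK₂ hL cS₂ hne hLne Set.inter_subset_left subset_rfl i21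
  have b22 := bm cK₂ cL₂ cS₃ hne hKl Set.inter_subset_left Set.inter_subset_left i22
  have p1 : 0 < (volume (toCylinder n '' K)).toReal := by linarith [nn K₂]
  have p2 : 0 < (volume (toCylinder n '' L)).toReal := by linarith [nn L₂]
  rcases le_total ((volume (toCylinder n '' K₂)).toReal * (volume (toCylinder n '' L)).toReal)
    ((volume (toCylinder n '' K)).toReal * (volume (toCylinder n '' L₂)).toReal) with hr | hr
  · have := brunnMinkowskiBound.add_min_le_of_ratio_le (n := n) hK21 (nn _) hL21 (nn _) p1 p2 hr
    linarith
  · have := brunnMinkowskiBound.add_min_le_of_ratio_le (n := n) hL21 (nn _) hK21 (nn _) p2 p1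
      (by linarith)
    rw [brunnMinkowskiBound.comm n _ (volume (toCylinder n '' K)).toReal,
      brunnMinkowskiBound.comm n _ (volume (toCylinder n '' K₂)).toReal,
      brunnMinkowskiBound.comm n _ (volume (toCylinder n '' K₂)).toReal,
      brunnMinkowskiBound.comm n _ (_ + _), min_comm] at this
    linarith

theorem volume_preimage_mul_fst {n : ℕ} {c : ℝ} (hc : 0 < c) {T : Set (ℝ × (Fin n → ℝ))}
    (hT : IsCompact T) :
    volume ((fun p : ℝ × (Fin n → ℝ) => (c * p.1, p.2)) ⁻¹' T) =
      ENNReal.ofReal c⁻¹ * volume T := by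
  have hm : Measurable fun p : ℝ × (Fin n → ℝ) => (c * p.1, p.2) := by fun_prop
  rw [Measure.volume_eq_prod, Measure.prod_apply_symm (hm hT.measurableSet),
    Measure.prod_apply_symm hT.measurableSet,
    ← lintegral_const_mul' _ _ ENNReal.ofReal_ne_top]
  refine lintegral_congr fun y => ?_
  have := Real.volume_preimage_mul_left hc.ne' ((fun s => (s, y)) ⁻¹' T)
  rw [abs_of_pos (by positivity)] at this
  exact this

theorem isCompact_preimage_mul_fst {n : ℕ} {c : ℝ} (hc : 0 < c) {T : Set (ℝ × (Fin n → ℝ))}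
    (hT : IsCompact T) : IsCompact ((fun p : ℝ × (Fin n → ℝ) => (c * p.1, p.2)) ⁻¹' T) :=
  ((Homeomorph.mulLeft₀ c hc.ne').prodCongr (Homeomorph.refl _)).isCompact_preimage.2 hT

theorem ofReal_brunnMinkowskiBound_add_min_le_of_mem_sub {n : ℕ} {K L : Set (ℝ × (Fin n → ℝ))}
    (hK : IsCompact K) (hL : IsCompact L) (hK0 : 0 < volume K) (hL0 : 0 < volume L)
    (hKf : ∀ y, volume ((fun s => (s, y)) ⁻¹' K) ≤ 1 / 2)
    (hLf : ∀ y, volume ((fun s => (s, y)) ⁻¹' L) ≤ 1 / 2)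
    (h : ((1 : ℝ), (0 : Fin n → ℝ)) ∈ (K - K) ∪ (L - L)) :
    ENNReal.ofReal (brunnMinkowskiBound n (volume K).toReal (volume L).toReal +
      min (volume K).toReal (volume L).toReal) ≤ volume (K + L) := by
  have hD : IsCompact ((K - K) ∪ (L - L)) := by
    simp only [sub_eq_add_neg]
    exact (hK.add hK.neg).union (hL.add hL.neg)
  obtain ⟨c, hcm, hcmax⟩ := (isCompact_preimage_prodMk hD 0).exists_isMaxOn ⟨1, h⟩
    (f := fun s : ℝ => s) continuousOn_id
  have hc1 : 1 ≤ c := hcmax h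
  have hc0 : 0 < c := by linarith
  set ψ : ℝ × (Fin n → ℝ) → ℝ × (Fin n → ℝ) := fun p => (c * p.1, p.2) with hψ
  have hψs : ∀ q, ∃ p, ψ p = q := fun q => ⟨(c⁻¹ * q.1, q.2), by
    simp [hψ, hc0.ne']⟩
  have hψi : Function.Injective ψ := fun p q hpq => by
    have h1 := congrArg Prod.fst hpq
    have h2 := congrArg Prod.snd hpq
    exact Prod.ext (mul_left_cancel₀ hc0.ne' h1) h2
  have hψa : ∀ p q, ψ (p + q) = ψ p + ψ q := fun p q => by
    ext <;> simp [hψ, mul_add]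
  have hsum : ψ ⁻¹' K + ψ ⁻¹' L = ψ ⁻¹' (K + L) := by
    ext z
    constructor
    · rintro ⟨p, hp, q, hq, rfl⟩
      rw [Set.mem_preimage, hψa]
      exact Set.add_mem_add hp hq
    · rintro ⟨p, hp, q, hq, hpq⟩
      obtain ⟨p, rfl⟩ := hψs p
      obtain ⟨q, rfl⟩ := hψs q
      refine ⟨p, hp, q, hq, hψi ?_⟩
      rw [hψa]
      exact hpq
  have hfib : ∀ {T : Set (ℝ × (Fin n → ℝ))}, (∀ y, volume ((fun s => (s, y)) ⁻¹' T) ≤ 1 / 2) →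
      ∀ y, volume ((fun s => (s, y)) ⁻¹' (ψ ⁻¹' T)) ≤ 1 / 2 := by
    intro T hT y
    have := Real.volume_preimage_mul_left hc0.ne' ((fun s => (s, y)) ⁻¹' T)
    rw [abs_of_pos (by positivity)] at this
    refine (le_of_eq this).trans ((mul_le_of_le_one_left' ?_).trans (hT y))
    rw [ENNReal.ofReal_le_one]
    exact inv_le_one_of_one_le₀ hc1
  have hdiff : ∀ {T : Set (ℝ × (Fin n → ℝ))}, T - T ⊆ (K - K) ∪ (L - L) →
      ∀ p ∈ ψ ⁻¹' T, ∀ q ∈ ψ ⁻¹' T, p.2 = q.2 → q.1 - p.1 < 2 := by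
    intro T hT p hp q hq hpq
    have : (c * q.1 - c * p.1, (0 : Fin n → ℝ)) ∈ (K - K) ∪ (L - L) := by
      convert hT (Set.sub_mem_sub hq hp) using 1
      ext <;> simp [hψ, hpq]
    have h1 : c * q.1 - c * p.1 ≤ c := hcmax this
    by_contra! h2
    nlinarith
  have hex : ∀ {T : Set (ℝ × (Fin n → ℝ))}, (c, (0 : Fin n → ℝ)) ∈ T - T →
      ∃ p ∈ ψ ⁻¹' T, (p.1 + 1, p.2) ∈ ψ ⁻¹' T := by
    rintro T ⟨a, ha, b, hb, hab⟩
    obtain ⟨b, rfl⟩ := hψs b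
    refine ⟨b, hb, ?_⟩
    have : ψ (b.1 + 1, b.2) = a := by
      obtain ⟨h1, h2⟩ := Prod.ext_iff.1 hab
      refine Prod.ext ?_ ?_
      · simp only [hψ, Prod.fst_sub] at h1 ⊢
        linarith
      · simp only [hψ, Prod.snd_sub] at h2 ⊢
        exact (sub_eq_zero.1 h2).symm
    rw [Set.mem_preimage, this]
    exact ha
  have vK := volume_preimage_mul_fst hc0 hK
  have vL := volume_preimage_mul_fst hc0 hL
  have vS := volume_preimage_mul_fst hc0 (hK.add hL)
  have cK := isCompact_preimage_mul_fst hc0 hK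
  have cL := isCompact_preimage_mul_fst hc0 hL
  rw [← hψ] at vK vL vS cK cL
  have hci : 0 < ENNReal.ofReal c⁻¹ := ENNReal.ofReal_pos.2 (by positivity)
  have pK : 0 < volume (ψ ⁻¹' K) := by
    rw [vK]
    exact ENNReal.mul_pos hci.ne' hK0.ne'
  have pL : 0 < volume (ψ ⁻¹' L) := by
    rw [vL]
    exact ENNReal.mul_pos hci.ne' hL0.ne'
  have key : ENNReal.ofReal (brunnMinkowskiBound n (volume (ψ ⁻¹' K)).toReal
      (volume (ψ ⁻¹' L)).toReal + min (volume (ψ ⁻¹' K)).toReal (volume (ψ ⁻¹' L)).toReal) ≤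
      volume (ψ ⁻¹' K + ψ ⁻¹' L) := by
    rcases hcm with hcm | hcm
    · rw [brunnMinkowskiBound.comm, min_comm, add_comm (ψ ⁻¹' K)]
      exact ofReal_brunnMinkowskiBound_add_min_le cL cK pL pK (hdiff Set.subset_union_right)
        (hdiff Set.subset_union_left) (hfib hLf) (hfib hKf) (hex hcm)
    · exact ofReal_brunnMinkowskiBound_add_min_le cK cL pK pL (hdiff Set.subset_union_left)
        (hdiff Set.subset_union_right) (hfib hKf) (hfib hLf) (hex hcm)
  have hci' : 0 ≤ c⁻¹ := by positivity
  rw [hsum, vK, vL, vS, ENNReal.toReal_mul, ENNReal.toReal_mul, ENNReal.toReal_ofReal hci',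
    brunnMinkowskiBound.mul_left hci' ENNReal.toReal_nonneg ENNReal.toReal_nonneg,
    ← mul_min_of_nonneg _ _ hci', ← mul_add, ENNReal.ofReal_mul hci'] at key
  exact (ENNReal.mul_le_mul_iff_right hci.ne' ENNReal.ofReal_ne_top).1 key

/-- If the sumset of two compact sets is small, and one of them contains two points differing by
the `i`-th basis vector, then one of them has a long fibre in the direction `i`. -/
theorem exists_half_lt_volume_fiber {n : ℕ} {K L : Set (Fin (n + 1) → ℝ)} (hK : IsCompact K)
    (hL : IsCompact L) (hK0 : 0 < volume K) (hL0 : 0 < volume L) (i : Fin (n + 1))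
    (h : Pi.single i 1 ∈ (K - K) ∪ (L - L))
    (hsmall : volume (K + L) <
      ENNReal.ofReal (brunnMinkowskiBound n (volume K).toReal (volume L).toReal +
        min (volume K).toReal (volume L).toReal)) :
    (∃ x, 1 / 2 < volume {s | Function.update x i s ∈ K}) ∨
      ∃ x, 1 / 2 < volume {s | Function.update x i s ∈ L} := by
  by_contra! hcon
  refine hsmall.not_ge ?_
  set G : ℝ × (Fin n → ℝ) → (Fin (n + 1) → ℝ) := fun p => i.insertNth p.1 p.2 with hG
  have hGv : ∀ T : Set (Fin (n + 1) → ℝ), IsCompact T → volume (G ⁻¹' T) = volume T :=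
    fun T hT => (volume_preserving_piFinSuccAbove (fun _ : Fin (n + 1) => ℝ) i).symm
      |>.measure_preimage hT.measurableSet.nullMeasurableSet
  have hGc : ∀ T : Set (Fin (n + 1) → ℝ), IsCompact T → IsCompact (G ⁻¹' T) :=
    fun T hT => by
      have : G ⁻¹' T = (fun x => (x i, i.removeNth x)) '' T := by
        ext p
        constructor
        · exact fun hp => ⟨_, hp, by simp [hG]⟩
        · rintro ⟨x, hx, rfl⟩
          simpa [hG] using hx
      rw [this]
      exact hT.image (continuous_apply i |>.prodMk
        (continuous_pi fun j => continuous_apply (i.succAbove j)))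
  have hGs : ∀ x, ∃ p, G p = x := fun x => ⟨(x i, i.removeNth x), by simp [hG]⟩
  have hGa : ∀ p q, G (p + q) = G p + G q := fun p q => by
    simp [hG, Fin.insertNth_add]
  have hGi : Function.Injective G := fun p q hpq => by
    have := (Fin.insertNth_inj (α := fun _ => ℝ)).1 hpq
    exact Prod.ext this.1 this.2
  have hsub : ∀ {T : Set (Fin (n + 1) → ℝ)}, Pi.single i 1 ∈ T - T →
      ((1 : ℝ), (0 : Fin n → ℝ)) ∈ G ⁻¹' T - G ⁻¹' T := by
    rintro T ⟨a, ha, b, hb, hab⟩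
    obtain ⟨a, rfl⟩ := hGs a
    obtain ⟨b, rfl⟩ := hGs b
    refine ⟨a, ha, b, hb, hGi (add_right_cancel (b := G b) ?_)⟩
    rw [← hGa, sub_add_cancel, ← sub_eq_iff_eq_add]
    refine hab.trans ?_
    simp [hG]
  have hsum : G ⁻¹' K + G ⁻¹' L = G ⁻¹' (K + L) := by
    ext z
    constructor
    · rintro ⟨p, hp, q, hq, rfl⟩
      rw [Set.mem_preimage, hGa]
      exact Set.add_mem_add hp hq
    · rintro ⟨p, hp, q, hq, hpq⟩
      obtain ⟨p, rfl⟩ := hGs p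
      obtain ⟨q, rfl⟩ := hGs q
      refine ⟨p, hp, q, hq, hGi ?_⟩
      rw [hGa]
      exact hpq
  have hupd : ∀ (y : Fin n → ℝ) (s : ℝ),
      Function.update (i.insertNth (0 : ℝ) y : Fin (n + 1) → ℝ) i s = G (s, y) := fun y s => by
    simp [hG]
  have key := ofReal_brunnMinkowskiBound_add_min_le_of_mem_sub (hGc K hK) (hGc L hL)
    (by rwa [hGv K hK]) (by rwa [hGv L hL])
    (fun y => by
      have := hcon.1 (i.insertNth (0 : ℝ) y : Fin (n + 1) → ℝ)
      simp only [hupd] at this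
      exact this)
    (fun y => by
      have := hcon.2 (i.insertNth (0 : ℝ) y : Fin (n + 1) → ℝ)
      simp only [hupd] at this
      exact this)
    (h.imp hsub hsub)
  rwa [hsum, hGv K hK, hGv L hL, hGv _ (hK.add hL)] at key

theorem volume_eq_lintegral_insertNth {n : ℕ} (i : Fin (n + 1)) {T : Set (Fin (n + 1) → ℝ)}
    (hT : MeasurableSet T) :
    volume T = ∫⁻ y : Fin n → ℝ, volume {s : ℝ | (i.insertNth s y : Fin (n + 1) → ℝ) ∈ T} := by
  have mp := (volume_preserving_piFinSuccAbove (fun _ : Fin (n + 1) => ℝ) i).symm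
  rw [← mp.measure_preimage hT.nullMeasurableSet, Measure.volume_eq_prod,
    Measure.prod_apply_symm (mp.measurable hT)]
  rfl

/-- If one set has a long fibre in the direction `i` and the fibres of a second one in that
direction are short, then the sumset is much larger than the second set. -/
theorem volume_mul_le_mul_volume_add {n : ℕ} {K L : Set (Fin (n + 1) → ℝ)} (hK : IsCompact K)
    (hL : IsCompact L) (i : Fin (n + 1)) {a b : ℝ≥0∞} (x : Fin (n + 1) → ℝ)
    (hx : a ≤ volume {s | Function.update x i s ∈ K})
    (hb : ∀ x, volume {s | Function.update x i s ∈ L} ≤ b) :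
    volume L * a ≤ b * volume (K + L) := by
  set Y : Set (Fin n → ℝ) := i.removeNth '' L with hY
  have hYc : IsCompact Y :=
    hL.image (continuous_pi fun j => continuous_apply (i.succAbove j))
  have hupd : ∀ (y : Fin n → ℝ) (s : ℝ), (i.insertNth s y : Fin (n + 1) → ℝ) =
      Function.update (i.insertNth (0 : ℝ) y : Fin (n + 1) → ℝ) i s := fun y s => by simp
  have hLY : volume L ≤ b * volume Y := by
    rw [volume_eq_lintegral_insertNth i hL.measurableSet, ← setLIntegral_const,
      ← lintegral_indicator hYc.measurableSet]
    refine lintegral_mono fun y => ?_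
    by_cases hy : y ∈ Y
    · rw [Set.indicator_of_mem hy]
      have h := hb (i.insertNth (0 : ℝ) y : Fin (n + 1) → ℝ)
      simp only [← hupd] at h
      exact h
    · have : {s : ℝ | (i.insertNth s y : Fin (n + 1) → ℝ) ∈ L} = ∅ := by
        ext s
        simp only [Set.mem_ofPred_eq, Set.mem_empty_iff_false, iff_false]
        exact fun h => hy ⟨_, h, by simp⟩
      simp only [this, measure_empty, zero_le]
  have hSY : a * volume Y ≤ volume (K + L) := by
    rw [volume_eq_lintegral_insertNth i (hK.add hL).measurableSet,
      ← lintegral_add_right_eq_self _ (i.removeNth x), ← setLIntegral_const,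
      ← lintegral_indicator hYc.measurableSet]
    refine lintegral_mono fun y => ?_
    by_cases hy : y ∈ Y
    · rw [Set.indicator_of_mem hy]
      obtain ⟨z, hz, rfl⟩ := hy
      refine hx.trans ?_
      rw [← measure_preimage_add_right volume (z i) {s : ℝ | (i.insertNth s
        (i.removeNth z + i.removeNth x) : Fin (n + 1) → ℝ) ∈ K + L}]
      refine measure_mono fun s hs => ?_
      refine ⟨_, hs, z, hz, ?_⟩
      rw [add_comm (i.removeNth z), Fin.insertNth_add]
      simp
    · rw [Set.indicator_of_notMem hy]
      exact zero_le
  calc volume L * a ≤ b * volume Y * a := by gcongr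
    _ = b * (a * volume Y) := by ring
    _ ≤ b * volume (K + L) := by gcongr

/-- A Loomis–Whitney type inequality: a lower bound for the volume of `K + L` where `L` has long
fibres in all coordinate directions. -/
theorem volume_pow_mul_pow_le {n : ℕ} {K L : Set (Fin (n + 1) → ℝ)} (hK : IsCompact K)
    (hL : IsCompact L) (hK0 : K.Nonempty) {a : ℝ≥0∞}
    (ha : ∀ i, ∃ x, a ≤ volume {s | Function.update x i s ∈ L}) :
    volume K ^ n * a ^ (n + 1) ≤ ((n + 1 : ℕ) * volume (K + L)) ^ (n + 1) := by
  choose q hq using ha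
  have hS := (hK.add hL).measurableSet
  set S : Fin (n + 1) → Set (Fin (n + 1) → ℝ) :=
    fun i => (fun x => x + Function.update (q i) i 0) ⁻¹' (K + L) with hSd
  have hSm : ∀ i, MeasurableSet (S i) := fun i => measurable_add_const _ hS
  set f : (Fin (n + 1) → ℝ) → ℝ≥0∞ := fun x => ∑ i, (S i).indicator 1 x with hf
  have hfm : Measurable f :=
    Finset.measurable_fun_sum _ fun i _ => measurable_one.indicator (hSm i)
  have hfi : ∫⁻ x, f x = (n + 1 : ℕ) * volume (K + L) := by
    rw [hf, lintegral_finsetSum _ fun i _ => measurable_one.indicator (hSm i)]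
    simp only [lintegral_indicator_one (hSm _)]
    simp [hSd, measure_preimage_add_right]
  have hfib : ∀ x ∈ K, ∀ i, a ≤ ∫⁻ s, f (Function.update x i s) := by
    intro x hx i
    refine (hq i).trans ?_
    have hm : MeasurableSet {s : ℝ | Function.update x i s ∈ S i} :=
      (measurable_update x) (hSm i)
    calc volume {s | Function.update (q i) i s ∈ L}
        ≤ volume {s : ℝ | Function.update x i s ∈ S i} := by
          rw [← measure_preimage_add volume (x i) {s : ℝ | Function.update x i s ∈ S i}]
          refine measure_mono fun s hs => ⟨x, hx, _, hs, ?_⟩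
          ext j
          by_cases hj : j = i
          · subst hj
            simp
          · simp [hj]
      _ = ∫⁻ s, {s : ℝ | Function.update x i s ∈ S i}.indicator 1 s :=
          (lintegral_indicator_one hm).symm
      _ ≤ ∫⁻ s, f (Function.update x i s) := by
          refine lintegral_mono fun s => ?_
          exact Finset.single_le_sum (f := fun i' => (S i').indicator (1 : (Fin (n + 1) → ℝ) → ℝ≥0∞)
            (Function.update x i s)) (fun _ _ => zero_le) (Finset.mem_univ i)
  rcases n.eq_zero_or_pos with rfl | hn
  · obtain ⟨x, hx⟩ := hK0
    have h1 := hfib x hx 0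
    have h2 := congrFun (lmarginal_univ (μ := fun _ : Fin (0 + 1) => (volume : Measure ℝ))
      (f := f)) x
    have h3 := congrFun (lmarginal_singleton (μ := fun _ : Fin (0 + 1) => (volume : Measure ℝ))
      f 0) x
    have h4 : (Finset.univ : Finset (Fin (0 + 1))) = {0} := rfl
    rw [h4] at h2
    rw [← h3, h2, ← volume_pi, hfi] at h1
    simpa using h1
  have hn' : (0 : ℝ) < n := by exact_mod_cast hn
  have hp : Real.HolderConjugate (Fintype.card (Fin (n + 1))) (((n : ℝ) + 1) / n) := by
    rw [Real.holderConjugate_iff]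
    simp only [Fintype.card_fin, Nat.cast_add, Nat.cast_one]
    exact ⟨by linarith, by field_simp; ring⟩
  have key := lintegral_prod_lintegral_pow_le (fun _ : Fin (n + 1) => (volume : Measure ℝ)) hp hfm
  rw [← volume_pi, hfi] at key
  have low : volume K * (a ^ (n + 1)) ^ ((n : ℝ)⁻¹) ≤
      ∫⁻ x, ∏ i, (∫⁻ s, f (Function.update x i s)) ^
        ((1 : ℝ) / ((Fintype.card (Fin (n + 1)) : ℝ) - 1)) := by
    rw [mul_comm, ← setLIntegral_const]
    refine le_trans (setLIntegral_mono' hK.measurableSet fun x hx => ?_)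
      (setLIntegral_le_lintegral K _)
    have he : (1 : ℝ) / ((Fintype.card (Fin (n + 1)) : ℝ) - 1) = (n : ℝ)⁻¹ := by
      simp
    rw [he, ENNReal.prod_rpow_of_nonneg (by positivity)]
    gcongr
    refine le_trans (le_of_eq ?_) (Finset.prod_le_prod' fun i _ => hfib x hx i)
    simp
  have := ENNReal.rpow_le_rpow (low.trans key) hn'.le
  rw [← ENNReal.rpow_mul, ENNReal.mul_rpow_of_nonneg _ _ hn'.le, ← ENNReal.rpow_mul,
    inv_mul_cancel₀ hn'.ne', ENNReal.rpow_one, div_mul_cancel₀ _ hn'.ne', ENNReal.rpow_natCast]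
    at this
  exact_mod_cast this

/-- If `K + L` is small, while `K` or `L` contains two points at distance one in each of the
coordinate directions, then `K + L` is not too small. -/
theorem le_volume_add_of_single_mem {n : ℕ} {K L : Set (Fin (n + 1) → ℝ)} (hK : IsCompact K)
    (hL : IsCompact L) {τ : ℝ} (hτ : 0 < τ) (hL0 : 0 < volume L)
    (hKτ : τ * (volume (K + L)).toReal ≤ (volume K).toReal)
    (hLτ : τ * (volume (K + L)).toReal ≤ (volume L).toReal) (hτ1 : τ ≤ 1)
    (h : ∀ i, Pi.single i 1 ∈ (K - K) ∪ (L - L)) (hK0 : 0 < volume K)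
    (hsmall : volume (K + L) <
      ENNReal.ofReal (brunnMinkowskiBound n (volume K).toReal (volume L).toReal +
        min (volume K).toReal (volume L).toReal)) :
    τ ^ n * (τ / 4) ^ (n + 1) ≤ (n + 1) ^ (n + 1) * (volume (K + L)).toReal := by
  have hKne := nonempty_of_measure_ne_zero hK0.ne'
  have hS : volume (K + L) ≠ ∞ := (hK.add hL).measure_lt_top.ne
  have hLS : volume L ≤ volume (K + L) := by
    obtain ⟨z, hz⟩ := hKne
    rw [← measure_vadd volume z L]
    exact measure_mono (by rintro _ ⟨w, hw, rfl⟩; exact Set.add_mem_add hz hw)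
  set σ := (volume (K + L)).toReal with hσ
  have hσ0 : 0 < σ := ENNReal.toReal_pos (hL0.trans_le hLS).ne' hS
  have hfib : ∀ i, ∃ x, ENNReal.ofReal (τ / 4) ≤ volume {s | Function.update x i s ∈ L} := by
    intro i
    by_contra! hcon
    rcases exists_half_lt_volume_fiber hK hL hK0 hL0 i (h i) hsmall with ⟨x, hx⟩ | ⟨x, hx⟩
    · have := volume_mul_le_mul_volume_add hK hL i x hx.le (fun x => (hcon x).le)
      have := ENNReal.toReal_mono (ENNReal.mul_ne_top ENNReal.ofReal_ne_top hS) this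
      rw [ENNReal.toReal_mul, ENNReal.toReal_mul, ENNReal.toReal_ofReal (by positivity), ← hσ]
        at this
      norm_num at this
      nlinarith
    · refine absurd (hx.trans (hcon x)) (not_lt.2 ?_)
      rw [ENNReal.ofReal_le_iff_le_toReal (by simp)]
      norm_num
      linarith
  have key := volume_pow_mul_pow_le hK hL hKne hfib
  have key := ENNReal.toReal_mono (by
    exact ENNReal.pow_ne_top (ENNReal.mul_ne_top (ENNReal.natCast_ne_top _) hS)) key
  rw [ENNReal.toReal_mul, ENNReal.toReal_pow, ENNReal.toReal_pow, ENNReal.toReal_pow,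
    ENNReal.toReal_mul, ENNReal.toReal_ofReal (by positivity), ENNReal.toReal_natCast, ← hσ,
    mul_pow, pow_succ σ] at key
  push_cast at key
  have h2 : (τ * σ) ^ n ≤ (volume K).toReal ^ n := by gcongr
  have h3 : (τ * σ) ^ n * (τ / 4) ^ (n + 1) ≤ (n + 1) ^ (n + 1) * (σ ^ n * σ) :=
    le_trans (by gcongr) key
  rw [mul_pow] at h3
  have hσn : 0 < σ ^ n := by positivity
  refine le_of_mul_le_mul_left ?_ hσn
  linarith

theorem abs_det_mul_le_of_isCompact {n : ℕ} {K L : Set (Fin (n + 1) → ℝ)} (hK : IsCompact K)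
    (hL : IsCompact L) {τ : ℝ} (hτ : 0 < τ) (hK0 : 0 < volume K) (hL0 : 0 < volume L)
    (hKτ : τ * (volume (K + L)).toReal ≤ (volume K).toReal)
    (hLτ : τ * (volume (K + L)).toReal ≤ (volume L).toReal) (hτ1 : τ ≤ 1)
    (f : (Fin (n + 1) → ℝ) →ₗ[ℝ] (Fin (n + 1) → ℝ))
    (h : ∀ i, f (Pi.single i 1) ∈ (K - K) ∪ (L - L))
    (hsmall : volume (K + L) <
      ENNReal.ofReal (brunnMinkowskiBound n (volume K).toReal (volume L).toReal +
        min (volume K).toReal (volume L).toReal)) :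
    |f.det| * (τ ^ n * (τ / 4) ^ (n + 1)) ≤ (n + 1) ^ (n + 1) * (volume (K + L)).toReal := by
  rcases eq_or_ne f.det 0 with h0 | h0
  · rw [h0, abs_zero, zero_mul]
    positivity
  set δ := |(f.det)⁻¹| with hδ
  have hδ0 : 0 < δ := abs_pos.2 (inv_ne_zero h0)
  have hker : LinearMap.ker f = ⊥ := by
    by_contra hne
    exact h0 (LinearMap.det_eq_zero_iff_ker_ne_bot.2 hne)
  have hinj := LinearMap.ker_eq_bot.1 hker
  have hsurj := LinearMap.injective_iff_surjective.1 hinj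
  have hemb := LinearMap.isClosedEmbedding_of_injective hker
  have hvol : ∀ T, volume (f ⁻¹' T) = ENNReal.ofReal δ * volume T :=
    fun T => Measure.addHaar_preimage_linearMap volume h0 T
  have hsum : f ⁻¹' K + f ⁻¹' L = f ⁻¹' (K + L) := by
    ext z
    constructor
    · rintro ⟨p, hp, q, hq, rfl⟩
      rw [Set.mem_preimage, map_add]
      exact Set.add_mem_add hp hq
    · rintro ⟨p, hp, q, hq, hpq⟩
      obtain ⟨p, rfl⟩ := hsurj p
      obtain ⟨q, rfl⟩ := hsurj q
      refine ⟨p, hp, q, hq, hinj ?_⟩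
      rw [map_add]
      exact hpq
  have hsub : ∀ {T : Set (Fin (n + 1) → ℝ)} {z}, f z ∈ T - T → z ∈ f ⁻¹' T - f ⁻¹' T := by
    rintro T z ⟨p, hp, q, hq, hpq⟩
    obtain ⟨p, rfl⟩ := hsurj p
    obtain ⟨q, rfl⟩ := hsurj q
    refine ⟨p, hp, q, hq, hinj ?_⟩
    rw [map_sub]
    exact hpq
  have hδe : ENNReal.ofReal δ ≠ 0 := (ENNReal.ofReal_pos.2 hδ0).ne'
  have tr : ∀ T, (volume (f ⁻¹' T)).toReal = δ * (volume T).toReal := fun T => by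
    rw [hvol, ENNReal.toReal_mul, ENNReal.toReal_ofReal hδ0.le]
  have key := le_volume_add_of_single_mem (hemb.isCompact_preimage hK)
    (hemb.isCompact_preimage hL) hτ (by rw [hvol]; exact ENNReal.mul_pos hδe hL0.ne')
    (by rw [hsum, tr, tr, mul_left_comm]; gcongr) (by rw [hsum, tr, tr, mul_left_comm]; gcongr)
    hτ1 (fun i => (h i).imp hsub hsub) (by rw [hvol]; exact ENNReal.mul_pos hδe hK0.ne')
    (by
      rw [hsum, tr, tr, hvol, brunnMinkowskiBound.mul_left hδ0.le ENNReal.toReal_nonneg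
        ENNReal.toReal_nonneg, ← mul_min_of_nonneg _ _ hδ0.le, ← mul_add,
        ENNReal.ofReal_mul hδ0.le]
      exact (ENNReal.mul_lt_mul_iff_right hδe ENNReal.ofReal_ne_top).2 hsmall)
  rw [hsum, tr] at key
  have hdd : |f.det| * δ = 1 := by
    rw [hδ, abs_inv, mul_inv_cancel₀ (abs_ne_zero.2 h0)]
  calc |f.det| * (τ ^ n * (τ / 4) ^ (n + 1))
      ≤ |f.det| * ((n + 1) ^ (n + 1) * (δ * (volume (K + L)).toReal)) := by gcongr
    _ = (|f.det| * δ) * ((n + 1) ^ (n + 1) * (volume (K + L)).toReal) := by ring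
    _ = _ := by rw [hdd, one_mul]

/-- If `A + B` is small then parallelepipeds spanned by differences of points in the same set
are small. -/
theorem abs_det_mul_le {n : ℕ} {A B : Set (Fin (n + 1) → ℝ)} (hA : MeasurableSet A)
    (hB : MeasurableSet B) {τ : ℝ} (hτ : 0 < τ) (hτ1 : τ ≤ 1) (hA0 : 0 < volume A)
    (hB0 : 0 < volume B) (hAt : volume A ≠ ∞) (hBt : volume B ≠ ∞) (hS : volume (A + B) ≠ ∞)
    (hAτ : τ * (volume (A + B)).toReal < (volume A).toReal)
    (hBτ : τ * (volume (A + B)).toReal < (volume B).toReal)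
    (hsmall : (volume (A + B)).toReal <
      brunnMinkowskiBound n (volume A).toReal (volume B).toReal +
        min (volume A).toReal (volume B).toReal)
    (f : (Fin (n + 1) → ℝ) →ₗ[ℝ] (Fin (n + 1) → ℝ))
    (h : ∀ i, f (Pi.single i 1) ∈ (A - A) ∪ (B - B)) :
    |f.det| * (τ ^ n * (τ / 4) ^ (n + 1)) ≤ (n + 1) ^ (n + 1) * (volume (A + B)).toReal := by
  set a := (volume A).toReal with ha
  set b := (volume B).toReal with hb
  set σ := (volume (A + B)).toReal with hσ
  have ha0 : 0 < a := ENNReal.toReal_pos hA0.ne' hAt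
  have hb0 : 0 < b := ENNReal.toReal_pos hB0.ne' hBt
  have hσ0 : 0 ≤ σ := ENNReal.toReal_nonneg
  have hM := hσ0.trans_lt hsmall
  obtain ⟨c, hc, hc1⟩ := exists_between (show max (max (τ * σ / a) (τ * σ / b))
    (σ / (brunnMinkowskiBound n a b + min a b)) < 1 by
      simp only [max_lt_iff, div_lt_one ha0, div_lt_one hb0, div_lt_one hM]
      exact ⟨⟨hAτ, hBτ⟩, hsmall⟩)
  simp only [max_lt_iff, div_lt_iff₀ ha0, div_lt_iff₀ hb0, div_lt_iff₀ hM] at hc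
  obtain ⟨⟨hca, hcb⟩, hcM⟩ := hc
  have hc0 : 0 < c := by
    by_contra! hneg
    have : c * a ≤ 0 := mul_nonpos_of_nonpos_of_nonneg hneg ha0.le
    have : 0 ≤ τ * σ := by positivity
    linarith
  have hreg : ∀ {T : Set (Fin (n + 1) → ℝ)}, MeasurableSet T → 0 < volume T → volume T ≠ ∞ →
      ∃ C ⊆ T, IsCompact C ∧ ENNReal.ofReal (c * (volume T).toReal) < volume C := by
    intro T hT hT0 hTt
    refine hT.exists_lt_isCompact ?_
    have : 0 < (volume T).toReal := ENNReal.toReal_pos hT0.ne' hTt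
    rw [ENNReal.ofReal_lt_iff_lt_toReal (by positivity) hTt]
    exact mul_lt_of_lt_one_left this hc1
  obtain ⟨K₀, hK₀A, hK₀, hK₀v⟩ := hreg hA hA0 hAt
  obtain ⟨L₀, hL₀B, hL₀, hL₀v⟩ := hreg hB hB0 hBt
  have hfin : ∀ i, ∃ P Q : Set (Fin (n + 1) → ℝ), P.Finite ∧ Q.Finite ∧ P ⊆ A ∧ Q ⊆ B ∧
      f (Pi.single i 1) ∈ (P - P) ∪ (Q - Q) := by
    intro i
    rcases h i with ⟨p, hp, q, hq, hpq⟩ | ⟨p, hp, q, hq, hpq⟩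
    · exact ⟨{p, q}, ∅, Set.toFinite _, Set.finite_empty, Set.pair_subset hp hq,
        Set.empty_subset _, Or.inl ⟨p, by simp, q, by simp, hpq⟩⟩
    · exact ⟨∅, {p, q}, Set.finite_empty, Set.toFinite _, Set.empty_subset _,
        Set.pair_subset hp hq, Or.inr ⟨p, by simp, q, by simp, hpq⟩⟩
  choose P Q hP hQ hPA hQB hPQ using hfin
  set K := K₀ ∪ ⋃ i, P i with hKd
  set L := L₀ ∪ ⋃ i, Q i with hLd
  have hK : IsCompact K := hK₀.union (Set.finite_iUnion hP).isCompact
  have hL : IsCompact L := hL₀.union (Set.finite_iUnion hQ).isCompact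
  have hKA : K ⊆ A := Set.union_subset hK₀A (Set.iUnion_subset hPA)
  have hLB : L ⊆ B := Set.union_subset hL₀B (Set.iUnion_subset hQB)
  have hKv := hK₀v.trans_le (measure_mono (μ := volume) (Set.subset_union_left : K₀ ⊆ K))
  have hLv := hL₀v.trans_le (measure_mono (μ := volume) (Set.subset_union_left : L₀ ⊆ L))
  have hKr := (ENNReal.ofReal_lt_iff_lt_toReal (by positivity) hK.measure_lt_top.ne).1 hKv
  have hLr := (ENNReal.ofReal_lt_iff_lt_toReal (by positivity) hL.measure_lt_top.ne).1 hLv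
  rw [← ha] at hKr
  rw [← hb] at hLr
  have hσK : (volume (K + L)).toReal ≤ σ :=
    ENNReal.toReal_mono hS (measure_mono (Set.add_subset_add hKA hLB))
  have hτσ : τ * (volume (K + L)).toReal ≤ τ * σ := by gcongr
  refine (abs_det_mul_le_of_isCompact hK hL hτ (zero_le.trans_lt hKv)
    (zero_le.trans_lt hLv) (by linarith) (by linarith) hτ1 f
    (fun i => (hPQ i).imp (fun hi => Set.sub_subset_sub ?_ ?_ hi)
      fun hi => Set.sub_subset_sub ?_ ?_ hi) ?_).trans (by gcongr)
  · exact (Set.subset_iUnion P i).trans Set.subset_union_right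
  · exact (Set.subset_iUnion P i).trans Set.subset_union_right
  · exact (Set.subset_iUnion Q i).trans Set.subset_union_right
  · exact (Set.subset_iUnion Q i).trans Set.subset_union_right
  · rw [ENNReal.lt_ofReal_iff_toReal_lt (hK.add hL).measure_lt_top.ne]
    refine hσK.trans_lt (hcM.trans_le ?_)
    rw [mul_add, ← brunnMinkowskiBound.mul_left hc0.le ha0.le hb0.le,
      mul_min_of_nonneg _ _ hc0.le]
    exact add_le_add (brunnMinkowskiBound.mono (by positivity) (by positivity) hKr.le hLr.le)
      (min_le_min hKr.le hLr.le)

/-- A set spanning parallelepipeds of bounded volume is contained in twice the symmetric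
parallelepiped spanned by some of its elements. -/
theorem exists_forall_mem_eq_toLin_of_abs_det_le {ι : Type*} [Fintype ι] [DecidableEq ι]
    {D : Set (ι → ℝ)} {C : ℝ} (hC : ∀ e : ι → ι → ℝ, (∀ i, e i ∈ D) → |(Matrix.of e).det| ≤ C)
    (h0 : ∃ e : ι → ι → ℝ, (∀ i, e i ∈ D) ∧ (Matrix.of e).det ≠ 0) :
    ∃ e : ι → ι → ℝ, (∀ i, e i ∈ D) ∧
      ∀ x ∈ D, ∃ c : ι → ℝ, (∀ i, |c i| ≤ 2) ∧ Matrix.toLin' (Matrix.of e).transpose c = x := by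
  set T : Set ℝ := (fun e : ι → ι → ℝ => |(Matrix.of e).det|) '' {e | ∀ i, e i ∈ D} with hT
  have hbdd : BddAbove T := ⟨C, by rintro _ ⟨e, he, rfl⟩; exact hC e he⟩
  obtain ⟨e₀, he₀, hd₀⟩ := h0
  have hpos : 0 < sSup T := (abs_pos.2 hd₀).trans_le (le_csSup hbdd ⟨e₀, he₀, rfl⟩)
  have hne : T.Nonempty := ⟨_, e₀, he₀, rfl⟩
  obtain ⟨_, ⟨e, he, rfl⟩, hlt⟩ := exists_lt_of_lt_csSup hne (half_lt_self hpos)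
  have hdet : 0 < |(Matrix.of e).det| := by linarith
  refine ⟨e, he, fun x hx => ?_⟩
  refine ⟨(Matrix.of e).det⁻¹ • (Matrix.of e).transpose.cramer x, fun i => ?_, ?_⟩
  · rw [Pi.smul_apply, smul_eq_mul, abs_mul, abs_inv, inv_mul_le_iff₀ hdet, Matrix.cramer_apply]
    have hup : ((Matrix.of e).transpose.updateCol i x) =
        (Matrix.of (Function.update e i x)).transpose := by
      rw [Matrix.updateCol_transpose]
      rfl
    have : |(Matrix.of (Function.update e i x)).det| ≤ sSup T := by
      refine le_csSup hbdd ⟨_, fun j => ?_, rfl⟩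
      by_cases hj : j = i
      · subst hj
        simpa using hx
      · simpa [hj] using he j
    rw [hup, Matrix.det_transpose]
    linarith
  · rw [map_smul, Matrix.toLin'_apply, Matrix.mulVec_cramer, Matrix.det_transpose, smul_smul,
      inv_mul_cancel₀ (abs_pos.1 hdet), one_smul]

theorem exists_det_ne_zero_of_mem_nhds {ι : Type*} [Fintype ι] [DecidableEq ι]
    {D : Set (ι → ℝ)} (hD : D ∈ nhds 0) :
    ∃ e : ι → ι → ℝ, (∀ i, e i ∈ D) ∧ (Matrix.of e).det ≠ 0 := by
  obtain ⟨r, hr, hrD⟩ := Metric.mem_nhds_iff.1 hD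
  refine ⟨fun i => Pi.single i (r / 2), fun i => hrD ?_, ?_⟩
  · rw [mem_ball_zero_iff, Pi.norm_single, Real.norm_of_nonneg (by positivity)]
    linarith
  · have : (Matrix.of fun i : ι => (Pi.single i (r / 2) : ι → ℝ)) =
        Matrix.diagonal fun _ => r / 2 := by
      ext i j
      simp [Matrix.diagonal, Pi.single_apply, eq_comm]
    rw [this, Matrix.det_diagonal]
    exact Finset.prod_ne_zero_iff.2 fun _ _ => by positivity

theorem mul_four_div_pow_le {n : ℕ} {t x V : ℝ} (ht0 : 0 < t) (ht2 : t ≤ 1 / 2) (hV : 0 ≤ V)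
    (h : x * ((t ^ (n + 1) / 2) ^ n * (t ^ (n + 1) / 2 / 4) ^ (n + 1)) ≤
      (n + 1) ^ (n + 1) * (2 * V)) :
    x * (4 / t) ^ (n + 1) ≤ (2 / (t * (1 - t))) ^ (4 * (n + 1) ^ 2) * V := by
  set X := 2 / (t * (1 - t)) with hX
  have h1t : 0 < 1 - t := by linarith
  have hXt : 2 ≤ X * t := by
    rw [hX, div_mul_eq_mul_div, le_div_iff₀ (by positivity)]
    nlinarith
  have hX4 : 4 ≤ X := by
    rw [hX, le_div_iff₀ (by positivity)]
    nlinarith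
  set N := (n + 1) ^ 2 with hN
  have hb : (64 : ℝ) ^ N ≤ X ^ (4 * N) * t ^ (2 * N) := by
    calc (64 : ℝ) ^ N = 2 ^ (2 * N) * 4 ^ (2 * N) := by
          rw [pow_mul, pow_mul, ← mul_pow]
          norm_num
      _ ≤ (X * t) ^ (2 * N) * X ^ (2 * N) := by gcongr
      _ = X ^ (4 * N) * t ^ (2 * N) := by ring
  have hn : (64 * (n + 1) : ℝ) ^ (n + 1) ≤ 64 ^ N := by
    rw [hN, sq, pow_mul]
    gcongr
    have h2 : n + 1 ≤ 64 ^ n := Nat.lt_pow_self (by norm_num)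
    have h2' : (n + 1 : ℝ) ≤ 64 ^ n := by exact_mod_cast h2
    rw [pow_succ']
    gcongr
  have htN : 0 < t ^ (2 * N) := by positivity
  refine le_of_mul_le_mul_right ?_ htN
  have e1 : (t ^ (n + 1) / 2) ^ n * (t ^ (n + 1) / 2 / 4) ^ (n + 1) * 64 ^ (n + 1) =
      2 * ((4 / t) ^ (n + 1) * t ^ (2 * N)) := by
    have e4 : t ^ (2 * N) = (t ^ (n + 1)) ^ n * (t ^ (n + 1)) ^ (n + 1) * t ^ (n + 1) := by
      rw [hN]
      ring
    have e5 : (4 / t) ^ (n + 1) * t ^ (n + 1) = 4 ^ (n + 1) := by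
      rw [← mul_pow, div_mul_cancel₀ _ ht0.ne']
    have e6 : (64 : ℝ) = 2 * 4 * (2 * 4) := by norm_num
    calc _ = 2 * ((t ^ (n + 1)) ^ n * (t ^ (n + 1)) ^ (n + 1) * 4 ^ (n + 1)) := by
          rw [div_div, div_pow, div_pow, e6, mul_pow, mul_pow, mul_pow]
          field_simp
          ring
      _ = _ := by
          rw [← e5, e4]
          ring
  calc x * (4 / t) ^ (n + 1) * t ^ (2 * N)
      = x * ((t ^ (n + 1) / 2) ^ n * (t ^ (n + 1) / 2 / 4) ^ (n + 1)) * 64 ^ (n + 1) / 2 := by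
        linear_combination -x / 2 * e1
    _ ≤ (n + 1) ^ (n + 1) * (2 * V) * 64 ^ (n + 1) / 2 := by gcongr
    _ = (64 * (n + 1)) ^ (n + 1) * V := by
        rw [mul_pow]
        ring
    _ ≤ X ^ (4 * N) * t ^ (2 * N) * V := by
        gcongr
        exact hn.trans hb
    _ = X ^ (4 * N) * V * t ^ (2 * N) := by ring

/-- If the differences of two sets lie in the images of cubes under a linear map, some translates of
the sets have a convex hull whose volume is controlled by the determinant of the map. -/
theorem exists_volume_convexHull_union_vadd_le {ι : Type*} [Fintype ι] {A B : Set (ι → ℝ)}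
    (hA : A.Nonempty) (hB : B.Nonempty) (f : (ι → ℝ) →ₗ[ℝ] (ι → ℝ)) {r : ℝ}
    (hfA : ∀ a ∈ A, ∀ a' ∈ A, ∃ c : ι → ℝ, (∀ i, |c i| ≤ r) ∧ f c = a - a')
    (hfB : ∀ b ∈ B, ∀ b' ∈ B, ∃ c : ι → ℝ, (∀ i, |c i| ≤ r) ∧ f c = b - b') :
    ∃ v : ι → ℝ, volume (convexHull ℝ (A ∪ (v +ᵥ B))) ≤
      ENNReal.ofReal |f.det| * ENNReal.ofReal (2 * r) ^ Fintype.card ι := by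
  obtain ⟨a₀, ha₀⟩ := hA
  obtain ⟨b₀, hb₀⟩ := hB
  set K : Set (ι → ℝ) := Set.Icc (fun _ => -r) (fun _ => r) with hK
  have hmem (c : ι → ℝ) (hc : ∀ i, |c i| ≤ r) : c ∈ K :=
    ⟨fun i => (abs_le.1 (hc i)).1, fun i => (abs_le.1 (hc i)).2⟩
  have hsub : A ∪ ((a₀ - b₀) +ᵥ B) ⊆ a₀ +ᵥ f '' K := by
    rintro _ (ha | ⟨b, hb, rfl⟩)
    · obtain ⟨c, hc, hfc⟩ := hfA _ ha _ ha₀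
      refine ⟨f c, ⟨c, hmem c hc, rfl⟩, ?_⟩
      simp only [hfc, vadd_eq_add]
      abel
    · obtain ⟨c, hc, hfc⟩ := hfB _ hb _ hb₀
      refine ⟨f c, ⟨c, hmem c hc, rfl⟩, ?_⟩
      simp only [hfc, vadd_eq_add]
      abel
  have hconv : Convex ℝ (a₀ +ᵥ f '' K) := ((convex_Icc _ _).linear_image f).vadd a₀
  refine ⟨a₀ - b₀, (measure_mono (convexHull_min hsub hconv)).trans_eq ?_⟩
  rw [measure_vadd, Measure.addHaar_image_linearMap, hK, Real.volume_Icc_pi]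
  simp [two_mul]

/-- **Explicit-constant form of the main theorem.**
For `d ≥ 1`, `t ∈ (0, 1/2]` and `A, B ⊆ ℝ^d` measurable of equal positive
finite volume with `|tA + (1-t)B| < (1 + t^d)|A|`, there is a translation `v`
such that `|co(A ∪ (B + v))| ≤ (2/(t(1-t)))^{4d²} |A|`. -/
theorem distinct_sets_threshold_explicit (d : ℕ) (hd : 1 ≤ d) (t : ℝ)
    (ht0 : 0 < t) (ht2 : t ≤ 1 / 2)
    (A B : Set (Fin d → ℝ)) (hA : MeasurableSet A) (hB : MeasurableSet B)
    (hAB : volume A = volume B) (hA0 : 0 < volume A) (hAfin : volume A < ⊤)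
    (hsmall : volume (t • A + (1 - t) • B) <
      ENNReal.ofReal (1 + t ^ d) * volume A) :
    ∃ v : Fin d → ℝ,
      volume (convexHull ℝ (A ∪ (v +ᵥ B))) ≤
        ENNReal.ofReal ((2 / (t * (1 - t))) ^ (4 * d ^ 2)) * volume A := by
  obtain ⟨n, rfl⟩ : ∃ n, d = n + 1 := ⟨d - 1, by omega⟩
  have h1t : 0 < 1 - t := by linarith
  set V := (volume A).toReal with hV
  have hVA : volume A = ENNReal.ofReal V := (ENNReal.ofReal_toReal hAfin.ne).symm
  have hV0 : 0 < V := ENNReal.toReal_pos hA0.ne' hAfin.ne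
  have hvol (r : ℝ) (hr : 0 < r) (S : Set (Fin (n + 1) → ℝ)) (hS : volume S = ENNReal.ofReal V) :
      volume (r • S) = ENNReal.ofReal (r ^ (n + 1) * V) := by
    rw [Measure.addHaar_smul, hS, Module.finrank_fin_fun, abs_of_pos (by positivity),
      ← ENNReal.ofReal_mul (by positivity)]
  have hvA := hvol t ht0 A hVA
  have hvB := hvol (1 - t) h1t B (hAB ▸ hVA)
  have htu : 0 < t ^ (n + 1) := by positivity
  have htu1 : t ^ (n + 1) ≤ 1 := pow_le_one₀ ht0.le (by linarith)
  have htv : t ^ (n + 1) ≤ (1 - t) ^ (n + 1) := by gcongr; linarith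
  have hrA : (volume (t • A)).toReal = t ^ (n + 1) * V := by
    rw [hvA, ENNReal.toReal_ofReal (by positivity)]
  have hrB : (volume ((1 - t) • B)).toReal = (1 - t) ^ (n + 1) * V := by
    rw [hvB, ENNReal.toReal_ofReal (by positivity)]
  rw [hVA, ← ENNReal.ofReal_mul (by positivity)] at hsmall
  have hS : volume (t • A + (1 - t) • B) ≠ ∞ := (hsmall.trans ENNReal.ofReal_lt_top).ne
  have hσ : (volume (t • A + (1 - t) • B)).toReal < (1 + t ^ (n + 1)) * V :=
    (ENNReal.lt_ofReal_iff_toReal_lt hS).1 hsmall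
  have hσ2 : (volume (t • A + (1 - t) • B)).toReal < 2 * V := hσ.trans_le (by gcongr; linarith)
  have hpA : 0 < volume (t • A) := by rw [hvA]; exact ENNReal.ofReal_pos.2 (by positivity)
  have hpB : 0 < volume ((1 - t) • B) := by rw [hvB]; exact ENNReal.ofReal_pos.2 (by positivity)
  have hmA : MeasurableSet (t • A) := hA.const_smul_of_ne_zero ht0.ne'
  have hτA : t ^ (n + 1) / 2 * (volume (t • A + (1 - t) • B)).toReal < t ^ (n + 1) * V := by
    nlinarith
  have hτB : t ^ (n + 1) / 2 * (volume (t • A + (1 - t) • B)).toReal <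
      (1 - t) ^ (n + 1) * V := hτA.trans_le (by gcongr)
  have hbm : (volume (t • A + (1 - t) • B)).toReal <
      brunnMinkowskiBound n (t ^ (n + 1) * V) ((1 - t) ^ (n + 1) * V) +
        min (t ^ (n + 1) * V) ((1 - t) ^ (n + 1) * V) := by
    rw [mul_comm _ V, mul_comm _ V, brunnMinkowskiBound.mul_left hV0.le htu.le (htu.le.trans htv),
      brunnMinkowskiBound.pow_pow ht0.le h1t.le, min_eq_left (by gcongr)]
    simpa [add_mul, mul_comm] using hσ
  set D : Set (Fin (n + 1) → ℝ) := (t • A - t • A) ∪ ((1 - t) • B - (1 - t) • B) with hD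
  have hdet (e : Fin (n + 1) → Fin (n + 1) → ℝ) (he : ∀ i, e i ∈ D) :
      |(Matrix.toLin' (Matrix.of e).transpose).det| *
        ((t ^ (n + 1) / 2) ^ n * (t ^ (n + 1) / 2 / 4) ^ (n + 1)) ≤
      (n + 1) ^ (n + 1) * (2 * V) := by
    refine (abs_det_mul_le hmA (hB.const_smul_of_ne_zero h1t.ne') (half_pos htu) (by linarith)
      hpA hpB (by simp [hvA]) (by simp [hvB]) hS (by rwa [hrA]) (by rwa [hrB])
      (by rwa [hrA, hrB]) _ fun i => ?_).trans (by gcongr)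
    rw [Matrix.toLin'_apply, Matrix.mulVec_single_one]
    exact he i
  have hDn : D ∈ nhds 0 := Filter.mem_of_superset
    (Measure.sub_mem_nhds_zero_of_addHaar_pos volume _ hmA hpA) Set.subset_union_left
  obtain ⟨e, he, hcov⟩ := exists_forall_mem_eq_toLin_of_abs_det_le
    (C := (n + 1) ^ (n + 1) * (2 * V) /
      ((t ^ (n + 1) / 2) ^ n * (t ^ (n + 1) / 2 / 4) ^ (n + 1)))
    (fun e he => by
      rw [le_div_iff₀ (by positivity)]
      simpa [LinearMap.det_toLin'] using hdet e he)
    (exists_det_ne_zero_of_mem_nhds hDn)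
  have hscale (r : ℝ) (htr : t ≤ r) (S : Set (Fin (n + 1) → ℝ)) (hSD : r • S - r • S ⊆ D) :
      ∀ x ∈ S, ∀ y ∈ S, ∃ c : Fin (n + 1) → ℝ, (∀ i, |c i| ≤ 2 / t) ∧
        Matrix.toLin' (Matrix.of e).transpose c = x - y := by
    intro x hx y hy
    have hr : 0 < r := ht0.trans_le htr
    obtain ⟨c, hc, hfc⟩ := hcov _ (hSD (Set.sub_mem_sub (Set.smul_mem_smul_set hx)
      (Set.smul_mem_smul_set hy)))
    refine ⟨r⁻¹ • c, fun i => ?_, ?_⟩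
    · rw [Pi.smul_apply, smul_eq_mul, abs_mul, abs_of_pos (inv_pos.2 hr), inv_mul_eq_div]
      exact div_le_div₀ (by norm_num) (hc i) ht0 htr
    · rw [map_smul, hfc, ← smul_sub, inv_smul_smul₀ hr.ne']
  obtain ⟨v, hv⟩ := exists_volume_convexHull_union_vadd_le
    (nonempty_of_measure_ne_zero hA0.ne') (nonempty_of_measure_ne_zero (hAB ▸ hA0.ne'))
    _ (hscale t le_rfl A Set.subset_union_left)
    (hscale (1 - t) (by linarith) B Set.subset_union_right)
  refine ⟨v, hv.trans ?_⟩
  rw [hVA, ← ENNReal.ofReal_mul (by positivity), Fintype.card_fin,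
    ← ENNReal.ofReal_pow (by positivity), ← ENNReal.ofReal_mul (abs_nonneg _)]
  refine ENNReal.ofReal_le_ofReal ?_
  rw [mul_div_assoc', show (2 * 2 : ℝ) = 4 by norm_num]
  exact mul_four_div_pow_le ht0 ht2 hV0.le (hdet e he)
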